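/- Let U be the ground state with asymptotics |x|^{(N-1)/2} e^{|x|} U(x) → L₀ > 0. If u is a positive solution of (1) with peaks at a_ε^1/ε < ... < a_ε^k/ε (mutual distances tending to infinity) and the associated Lyapunov–Schmidt coefficients d_i all vanish, then the peaks are asymptotically equidistributed: (a_ε^{i+1} - a_ε^i)/ε - 2π/(kε) → 0 as ε → 0 for all i. -/

import Mathlib

open Real Filter Topology MeasureTheory

/-- Unit vector along the first coordinate axis of `ℝ^N`. -/
noncomputable def e1 (N : ℕ) : EuclideanSpace ℝ (Fin N) :=
  if h : 0 < N then EuclideanSpace.single (⟨0, h⟩ : Fin N) (1 : ℝ) else 0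

/-- Laplacian of a function on `ℝ^N`. -/
noncomputable def lap {N : ℕ} (f : EuclideanSpace ℝ (Fin N) → ℝ)
    (x : EuclideanSpace ℝ (Fin N)) : ℝ :=
  ∑ i : Fin N, deriv (deriv (fun t : ℝ => f (x + t • EuclideanSpace.single i (1 : ℝ)))) 0

/-- The operator `ℳ(u) = -Δu + u - u₊^p`. -/
noncomputable def Mcal {N : ℕ} (p : ℝ) (u : EuclideanSpace ℝ (Fin N) → ℝ)
    (x : EuclideanSpace ℝ (Fin N)) : ℝ :=
  -(lap u x) + u x - max (u x) 0 ^ p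

/-- The cyclic gap `a^{i+1} - a^i` of a configuration of `k` points in `[-π, π)`
(the last gap wraps around the period `2π`). -/
noncomputable def gap (k : ℕ) (hk : 0 < k) (av : Fin k → ℝ) (i : Fin k) : ℝ :=
  (if h : (i : ℕ) + 1 < k then av ⟨(i : ℕ) + 1, h⟩ else av ⟨0, hk⟩ + 2 * Real.pi) - av i

/-- Minimal half-separation `σ̲` of the rescaled peak configuration `a i / ε`. -/
noncomputable def sigmin (k : ℕ) (hk : 0 < k) (av : Fin k → ℝ) (ε : ℝ) : ℝ :=
  (Finset.univ.inf' ⟨⟨0, hk⟩, Finset.mem_univ _⟩ fun i => gap k hk av i) / (2 * ε)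

/-- Partial derivative in the `i`-th coordinate direction. -/
noncomputable def coordDeriv {N : ℕ} (i : Fin N) (f : EuclideanSpace ℝ (Fin N) → ℝ)
    (x : EuclideanSpace ℝ (Fin N)) : ℝ :=
  fderiv ℝ f x (EuclideanSpace.single i (1 : ℝ))

section Calculus

variable {N : ℕ} {f g : EuclideanSpace ℝ (Fin N) → ℝ}

lemma deriv_line (hf : Differentiable ℝ f) (x v : EuclideanSpace ℝ (Fin N)) (t : ℝ) :
    deriv (fun t : ℝ => f (x + t • v)) t = fderiv ℝ f (x + t • v) v := by
  have h1 : HasDerivAt (fun t : ℝ => x + t • v) v t := by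
    simpa using ((hasDerivAt_id t).smul_const v).const_add x
  exact ((hf _).hasFDerivAt.comp_hasDerivAt t h1).deriv

lemma contDiff_coordDeriv {n : WithTop ℕ∞} (i : Fin N) (hf : ContDiff ℝ (n + 1) f) :
    ContDiff ℝ n (coordDeriv i f) :=
  (hf.fderiv_right le_rfl).clm_apply contDiff_const

lemma lap_eq_sum (hf : ContDiff ℝ 2 f) (x : EuclideanSpace ℝ (Fin N)) :
    lap f x = ∑ i, coordDeriv i (coordDeriv i f) x := by
  refine Finset.sum_congr rfl fun i _ => ?_
  have h1 : deriv (fun t : ℝ => f (x + t • EuclideanSpace.single i (1 : ℝ))) =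
      fun t : ℝ => coordDeriv i f (x + t • EuclideanSpace.single i (1 : ℝ)) := by
    funext t
    exact deriv_line (hf.differentiable (by norm_num)) x _ t
  rw [h1, deriv_line ((contDiff_coordDeriv (n := 1) i
    (by simpa [one_add_one_eq_two] using hf)).differentiable (by norm_num))]
  simp [coordDeriv]

lemma continuous_coordDeriv (i : Fin N) (hf : ContDiff ℝ 1 f) : Continuous (coordDeriv i f) :=
  (contDiff_coordDeriv (n := 0) i (by simpa using hf)).continuous

lemma contDiff_one_coordDeriv (i : Fin N) (hf : ContDiff ℝ 2 f) :
    ContDiff ℝ 1 (coordDeriv i f) :=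
  contDiff_coordDeriv (n := 1) i (by simpa [one_add_one_eq_two] using hf)

lemma continuous_lap (hf : ContDiff ℝ 2 f) : Continuous (lap f) := by
  rw [show lap f = _ from funext (lap_eq_sum hf)]
  exact continuous_finsetSum _ fun i _ =>
    continuous_coordDeriv i (contDiff_one_coordDeriv i hf)

lemma HasCompactSupport.coordDeriv (i : Fin N) (hf : HasCompactSupport f) :
    HasCompactSupport (coordDeriv i f) :=
  hf.fderiv_apply ℝ _

lemma integral_mul_coordDeriv (i : Fin N) (hf : ContDiff ℝ 1 f) (hg : ContDiff ℝ 1 g)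
    (hc : HasCompactSupport g) :
    ∫ x, f x * coordDeriv i g x = -∫ x, coordDeriv i f x * g x := by
  refine integral_mul_fderiv_eq_neg_fderiv_mul_of_integrable ?_ ?_ ?_
    (fun x _ => hf.differentiable (by norm_num) x) (fun x _ => hg.differentiable (by norm_num) x)
  · exact ((continuous_coordDeriv i hf).mul hg.continuous).integrable_of_hasCompactSupport
      hc.mul_left
  · exact (hf.continuous.mul (continuous_coordDeriv i hg)).integrable_of_hasCompactSupport
      (HasCompactSupport.mul_left (hc.coordDeriv i))
  · exact (hf.continuous.mul hg.continuous).integrable_of_hasCompactSupport hc.mul_left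

/-- Green's second identity for a compactly supported test function. -/
lemma integral_mul_lap (hf : ContDiff ℝ 2 f) (hg : ContDiff ℝ 2 g) (hc : HasCompactSupport g) :
    ∫ x, f x * lap g x = ∫ x, lap f x * g x := by
  have hf1 := hf.of_le (m := 1) (by norm_num)
  have hg1 := hg.of_le (m := 1) (by norm_num)
  have key : ∀ i : Fin N, ∫ x, f x * coordDeriv i (coordDeriv i g) x =
      ∫ x, coordDeriv i (coordDeriv i f) x * g x := fun i => by
    rw [integral_mul_coordDeriv i hf1 (contDiff_one_coordDeriv i hg) (hc.coordDeriv i),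
      integral_mul_coordDeriv i (contDiff_one_coordDeriv i hf) hg1 hc, neg_neg]
  simp_rw [lap_eq_sum hf, lap_eq_sum hg, Finset.mul_sum, Finset.sum_mul]
  rw [integral_finsetSum, integral_finsetSum]
  · exact Finset.sum_congr rfl fun i _ => key i
  · exact fun i _ => ((continuous_coordDeriv i (contDiff_one_coordDeriv i hf)).mul
      hg.continuous).integrable_of_hasCompactSupport hc.mul_left
  · exact fun i _ => (hf.continuous.mul (continuous_coordDeriv i
      (contDiff_one_coordDeriv i hg))).integrable_of_hasCompactSupport
        (HasCompactSupport.mul_left ((hc.coordDeriv i).coordDeriv i))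

lemma coordDeriv_mul (i : Fin N) (hf : Differentiable ℝ f) (hg : Differentiable ℝ g) :
    coordDeriv i (fun x => f x * g x) =
      fun x => coordDeriv i f x * g x + f x * coordDeriv i g x := by
  funext x
  have := ((hf x).hasFDerivAt.mul (hg x).hasFDerivAt).fderiv
  simp only [coordDeriv]
  erw [this]
  simp
  ring

lemma coordDeriv_add (i : Fin N) (hf : Differentiable ℝ f) (hg : Differentiable ℝ g) :
    coordDeriv i (fun x => f x + g x) = fun x => coordDeriv i f x + coordDeriv i g x := by
  funext x
  simp only [coordDeriv]
  rw [fderiv_fun_add (hf x) (hg x)]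
  simp

lemma lap_mul (hf : ContDiff ℝ 2 f) (hg : ContDiff ℝ 2 g) (x : EuclideanSpace ℝ (Fin N)) :
    lap (fun x => f x * g x) x =
      lap f x * g x + 2 * ∑ i, coordDeriv i f x * coordDeriv i g x + f x * lap g x := by
  have hf1 := hf.differentiable (by norm_num)
  have hg1 := hg.differentiable (by norm_num)
  have hf2 := fun i => (contDiff_one_coordDeriv i hf).differentiable one_ne_zero
  have hg2 := fun i => (contDiff_one_coordDeriv i hg).differentiable one_ne_zero
  rw [lap_eq_sum (hf.mul hg), lap_eq_sum hf, lap_eq_sum hg, Finset.sum_mul, Finset.mul_sum,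
    Finset.mul_sum, ← Finset.sum_add_distrib, ← Finset.sum_add_distrib]
  refine Finset.sum_congr rfl fun i _ => ?_
  rw [coordDeriv_mul i hf1 hg1, coordDeriv_add i (f := fun x => coordDeriv i f x * g x)
      (g := fun x => f x * coordDeriv i g x) ((hf2 i).mul hg1) (hf1.mul (hg2 i)),
    coordDeriv_mul i (hf2 i) hg1, coordDeriv_mul i hf1 (hg2 i)]
  ring

lemma coordDeriv_comp_smul (i : Fin N) (c : ℝ) (f : EuclideanSpace ℝ (Fin N) → ℝ) :
    coordDeriv i (fun x => f (c • x)) = fun x => c * coordDeriv i f (c • x) := by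
  funext x
  simp only [coordDeriv]
  rw [fderiv_comp_smul]
  simp

lemma coordDeriv_const_mul (i : Fin N) (c : ℝ) (hf : Differentiable ℝ f) :
    coordDeriv i (fun x => c * f x) = fun x => c * coordDeriv i f x := by
  funext x
  simp only [coordDeriv]
  rw [fderiv_const_mul (hf x)]
  simp

lemma lap_comp_smul (c : ℝ) (hf : ContDiff ℝ 2 f) (x : EuclideanSpace ℝ (Fin N)) :
    lap (fun x => f (c • x)) x = c ^ 2 * lap f (c • x) := by
  rw [lap_eq_sum (f := fun x => f (c • x)) (hf.comp (contDiff_const_smul c)), lap_eq_sum hf,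
    Finset.mul_sum]
  refine Finset.sum_congr rfl fun i _ => ?_
  have h := (contDiff_one_coordDeriv i hf).differentiable one_ne_zero
  rw [coordDeriv_comp_smul, coordDeriv_const_mul i c (f := fun x => coordDeriv i f (c • x))
      (h.comp (differentiable_id.const_smul c)),
    coordDeriv_comp_smul]
  ring

lemma coordDeriv_comp_sub (i : Fin N) (y : EuclideanSpace ℝ (Fin N))
    (f : EuclideanSpace ℝ (Fin N) → ℝ) :
    coordDeriv i (fun x => f (x - y)) = fun x => coordDeriv i f (x - y) := by
  funext x
  simp only [coordDeriv]
  rw [fderiv_comp_sub]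

lemma lap_comp_sub (y : EuclideanSpace ℝ (Fin N)) (hf : ContDiff ℝ 2 f)
    (x : EuclideanSpace ℝ (Fin N)) :
    lap (fun x => f (x - y)) x = lap f (x - y) := by
  rw [lap_eq_sum (f := fun x => f (x - y)) (hf.comp (contDiff_id.sub contDiff_const)),
    lap_eq_sum hf]
  refine Finset.sum_congr rfl fun i _ => ?_
  rw [coordDeriv_comp_sub, coordDeriv_comp_sub]

lemma lap_eq_zero_of_eventuallyEq_const {c : ℝ} {x : EuclideanSpace ℝ (Fin N)}
    (hf : ContDiff ℝ 2 f) (h : f =ᶠ[𝓝 x] fun _ => c) : lap f x = 0 := by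
  rw [lap_eq_sum hf]
  refine Finset.sum_eq_zero fun i _ => ?_
  have h1 : coordDeriv i f =ᶠ[𝓝 x] fun _ => 0 := by
    filter_upwards [h.eventuallyEq_nhds] with y hy
    simp only [coordDeriv]
    rw [hy.fderiv_eq]
    simp
  simp only [coordDeriv] at h1 ⊢
  rw [h1.fderiv_eq]
  simp

lemma coordDeriv_eq_zero_of_eventuallyEq_const {c : ℝ} {x : EuclideanSpace ℝ (Fin N)} (i : Fin N)
    (h : f =ᶠ[𝓝 x] fun _ => c) : coordDeriv i f x = 0 := by
  simp only [coordDeriv]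
  rw [h.fderiv_eq]
  simp

lemma coordDeriv_comp_coord {h h' : ℝ → ℝ} (i j : Fin N) (hh : ∀ t, HasDerivAt h (h' t) t) :
    coordDeriv i (fun x : EuclideanSpace ℝ (Fin N) => h (x j)) =
      fun x => if i = j then h' (x j) else 0 := by
  funext x
  have h1 : HasFDerivAt (fun x : EuclideanSpace ℝ (Fin N) => x j)
      (EuclideanSpace.proj j : EuclideanSpace ℝ (Fin N) →L[ℝ] ℝ) x :=
    (EuclideanSpace.proj j : EuclideanSpace ℝ (Fin N) →L[ℝ] ℝ).hasFDerivAt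
  have h2 := ((hh (x j)).comp_hasFDerivAt x h1).fderiv
  simp only [coordDeriv]
  erw [h2]
  by_cases hij : i = j
  · subst hij; simp
  · simp [hij, Ne.symm hij]

end Calculus

/-- A positive `C²` solution of `-ΔU + U = U ^ p` with the decay
`|x| ^ ((N - 1) / 2) * exp |x| * U x → L₀` at infinity. -/
structure IsDecayingSolution {N : ℕ} (p L₀ : ℝ) (U : EuclideanSpace ℝ (Fin N) → ℝ) : Prop where
  pos : ∀ x, 0 < U x
  contDiff : ContDiff ℝ 2 U
  lap_eq : ∀ x, lap U x = U x - U x ^ p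
  tendsto : Tendsto
    (fun x : EuclideanSpace ℝ (Fin N) => ‖x‖ ^ (((N : ℝ) - 1) / 2) * Real.exp ‖x‖ * U x)
    (Filter.comap (fun x : EuclideanSpace ℝ (Fin N) => ‖x‖) Filter.atTop) (nhds L₀)

lemma integrable_exp_neg_norm (N : ℕ) :
    Integrable (fun x : EuclideanSpace ℝ (Fin N) => Real.exp (-‖x‖)) := by
  have h := (integrable_one_add_norm (E := EuclideanSpace ℝ (Fin N)) (μ := volume)
    (r := (N + 1 : ℕ)) (by simp)).const_mul (Real.exp 1 * (N + 1).factorial)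
  refine h.mono' (by fun_prop) (Eventually.of_forall fun x => ?_)
  have h0 : 0 ≤ ‖x‖ := norm_nonneg x
  have h1 := Real.pow_div_factorial_le_exp (1 + ‖x‖) (by positivity) (N + 1)
  rw [Real.norm_of_nonneg (Real.exp_pos _).le, Real.rpow_neg (by positivity), Real.rpow_natCast,
    Real.exp_neg, ← div_eq_mul_inv, inv_eq_one_div, div_le_div_iff₀ (Real.exp_pos _)
    (by positivity)]
  rw [div_le_iff₀ (by positivity), Real.exp_add] at h1
  nlinarith [h1]

lemma eventually_norm_comap {E : Type*} [Norm E] {P : E → Prop}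
    (h : ∀ᶠ x in Filter.comap (fun x : E => ‖x‖) atTop, P x) : ∃ R : ℝ, ∀ x, R ≤ ‖x‖ → P x := by
  rw [eventually_comap] at h
  obtain ⟨R, hR⟩ := eventually_atTop.1 h
  exact ⟨R, fun x hx => hR _ hx x rfl⟩

namespace IsDecayingSolution

variable {N : ℕ} {p L₀ : ℝ} {U : EuclideanSpace ℝ (Fin N) → ℝ}

lemma exists_decay_rpow (hU : IsDecayingSolution p L₀ U) (hN : 2 ≤ N) :
    ∃ C > 0, ∀ x, ‖x‖ ^ (((N : ℝ) - 1) / 2) * Real.exp ‖x‖ * U x ≤ C := by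
  have hm : 0 ≤ ((N : ℝ) - 1) / 2 := by
    have : (2 : ℝ) ≤ N := by exact_mod_cast hN
    linarith
  obtain ⟨R, hR⟩ := eventually_norm_comap (hU.tendsto.eventually (gt_mem_nhds (lt_add_one L₀)))
  have hc : Continuous fun x : EuclideanSpace ℝ (Fin N) =>
      ‖x‖ ^ (((N : ℝ) - 1) / 2) * Real.exp ‖x‖ * U x :=
    ((continuous_norm.rpow_const fun _ => Or.inr hm).mul (by fun_prop)).mul hU.contDiff.continuous
  obtain ⟨C, hC⟩ := (isCompact_closedBall (0 : EuclideanSpace ℝ (Fin N)) R).bddAbove_image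
    hc.continuousOn
  refine ⟨max 1 (max C (L₀ + 1)), by positivity, fun x => ?_⟩
  rcases le_total R ‖x‖ with h | h
  · exact (hR x h).le.trans (by simp)
  · exact (hC ⟨x, by simpa using h, rfl⟩).trans (by simp)

lemma exists_decay (hU : IsDecayingSolution p L₀ U) (hN : 2 ≤ N) :
    ∃ C > 0, ∀ x, U x ≤ C * Real.exp (-‖x‖) := by
  have hm : 0 ≤ ((N : ℝ) - 1) / 2 := by
    have : (2 : ℝ) ≤ N := by exact_mod_cast hN
    linarith
  obtain ⟨C₁, hC₁, h₁⟩ := hU.exists_decay_rpow hN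
  obtain ⟨C, hC⟩ := (isCompact_closedBall (0 : EuclideanSpace ℝ (Fin N)) 1).bddAbove_image
    (f := fun x => Real.exp ‖x‖ * U x)
    ((by fun_prop : Continuous fun x : EuclideanSpace ℝ (Fin N) => Real.exp ‖x‖).mul
      hU.contDiff.continuous).continuousOn
  refine ⟨max C₁ C, by positivity, fun x => ?_⟩
  rw [Real.exp_neg, ← div_eq_mul_inv, le_div_iff₀ (Real.exp_pos _), mul_comm]
  rcases le_total 1 ‖x‖ with h | h
  · refine le_trans ?_ ((h₁ x).trans (le_max_left _ _))
    rw [mul_assoc]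
    exact le_mul_of_one_le_left (mul_nonneg (Real.exp_pos _).le (hU.pos x).le)
      (Real.one_le_rpow h hm)
  · exact (hC ⟨x, by simpa using h, rfl⟩).trans (by simp)

lemma continuous_rpow (hU : IsDecayingSolution p L₀ U) (q : ℝ) : Continuous fun x => U x ^ q :=
  hU.contDiff.continuous.rpow_const fun x => Or.inl (hU.pos x).ne'

lemma rpow_mul_exp_le (hU : IsDecayingSolution p L₀ U) {C : ℝ} (hC0 : 0 < C)
    (hC : ∀ x, U x ≤ C * Real.exp (-‖x‖)) {q : ℝ} (hq : 0 ≤ q)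
    (x : EuclideanSpace ℝ (Fin N)) : U x ^ q ≤ C ^ q * Real.exp (-(q * ‖x‖)) := by
  have := Real.rpow_le_rpow (hU.pos x).le (hC x) hq
  rwa [Real.mul_rpow hC0.le (Real.exp_pos _).le, ← Real.exp_mul, neg_mul, mul_comm ‖x‖] at this

/-- Local energy estimate for the solution. -/
lemma integral_sq_coordDeriv_le (hU : IsDecayingSolution p L₀ U) (hN : 2 ≤ N) (hp : 2 ≤ p)
    (i : Fin N) (χ : ContDiffBump (0 : EuclideanSpace ℝ (Fin N))) :
    ∃ K : ℝ, ∀ y, ∫ x, χ (x - y) * coordDeriv i U x ^ 2 ≤ K * Real.exp (-(2 * ‖y‖)) := by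
  obtain ⟨C, hC0, hC⟩ := hU.exists_decay hN
  have hχ2 : ContDiff ℝ 2 (χ : EuclideanSpace ℝ (Fin N) → ℝ) := χ.contDiff
  have hlapc : Continuous (lap χ) := continuous_lap hχ2
  obtain ⟨B, hB⟩ := (isCompact_closedBall (0 : EuclideanSpace ℝ (Fin N)) χ.rOut).bddAbove_image
    (f := fun x => |lap χ x|) hlapc.abs.continuousOn
  have hlap0 : ∀ x, χ.rOut < ‖x‖ → lap χ x = 0 := fun x hx => by
    refine lap_eq_zero_of_eventuallyEq_const (c := 0) hχ2 ?_
    filter_upwards [(isOpen_lt continuous_const continuous_norm).mem_nhds hx] with z hz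
    exact χ.zero_of_le_dist (by simpa using le_of_lt hz)
  set r := χ.rOut with hr
  have hB0 : 0 ≤ B := (abs_nonneg _).trans (hB ⟨0, by simp [hr, χ.rOut_pos.le], rfl⟩)
  set S : ℝ := (B + C ^ (p - 1)) * (C ^ 2 * Real.exp (2 * r)) with hS
  have hS0 : 0 ≤ S := by positivity
  refine ⟨S * volume.real (Metric.closedBall (0 : EuclideanSpace ℝ (Fin N)) r), fun y => ?_⟩
  have hφ : ContDiff ℝ 2 (fun x => χ (x - y)) := hχ2.comp (contDiff_id.sub contDiff_const)
  have hφc : HasCompactSupport (fun x => χ (x - y)) :=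
    χ.hasCompactSupport.comp_homeomorph (Homeomorph.subRight y)
  have hU2 := hU.contDiff
  have hD : ∀ j, Continuous (coordDeriv j U) := fun j =>
    continuous_coordDeriv j (hU2.of_le (by norm_num))
  have green := integral_mul_lap (hU2.mul hU2) hφ hφc
  have hint : ∀ f : EuclideanSpace ℝ (Fin N) → ℝ, Continuous f →
      Integrable (fun x => f x * χ (x - y)) := fun f hf =>
    (hf.mul hφ.continuous).integrable_of_hasCompactSupport hφc.mul_left
  have hlapint : Integrable (fun x => U x * U x * lap (fun x => χ (x - y)) x) := by
    simp_rw [lap_comp_sub y hχ2]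
    refine ((hU2.continuous.mul hU2.continuous).mul
      (hlapc.comp (continuous_id.sub continuous_const))).integrable_of_hasCompactSupport ?_
    refine HasCompactSupport.mul_left (HasCompactSupport.comp_homeomorph (f := lap χ) ?_
      (Homeomorph.subRight y))
    exact HasCompactSupport.intro (isCompact_closedBall 0 r) fun x hx => hlap0 x (by simpa using hx)
  have hsq : ∀ x, lap (fun x => U x * U x) x =
      2 * (U x * (U x - U x ^ p) + ∑ j, coordDeriv j U x ^ 2) := fun x => by
    rw [lap_mul hU2 hU2, hU.lap_eq]
    simp_rw [← sq]
    ring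
  have hballvol : volume.real (Metric.closedBall y r) =
      volume.real (Metric.closedBall (0 : EuclideanSpace ℝ (Fin N)) r) := by
    simp [Measure.real, Measure.addHaar_closedBall_center]
  have iA : Integrable fun x =>
      (U x * (U x - U x ^ p) + ∑ j, coordDeriv j U x ^ 2) * χ (x - y) :=
    hint _ ((hU2.continuous.mul (hU2.continuous.sub (hU.continuous_rpow p))).add
      (continuous_finsetSum _ fun j _ => (hD j).pow 2))
  have iB : Integrable fun x => U x * U x ^ p * χ (x - y) :=
    hint _ (hU2.continuous.mul (hU.continuous_rpow p))
  have hone : ∫ x, (χ (x - y) * coordDeriv i U x ^ 2) ≤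
      ∫ x, (Metric.closedBall y r).indicator (fun _ => S * Real.exp (-(2 * ‖y‖))) x := by
    have e1 : ∫ x, (U x * (U x - U x ^ p) + ∑ j, coordDeriv j U x ^ 2) * χ (x - y) =
        ∫ x, (1 / 2) * (U x * U x * lap (fun x => χ (x - y)) x) := by
      rw [integral_const_mul, green, ← integral_const_mul]
      congr 1; funext x; rw [hsq]; ring
    have e2 : ∫ x, χ (x - y) * coordDeriv i U x ^ 2 ≤
        ∫ x, ((U x * (U x - U x ^ p) + ∑ j, coordDeriv j U x ^ 2) * χ (x - y) +
          U x * U x ^ p * χ (x - y)) := by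
      refine integral_mono ?_ ?_ fun x => ?_
      · simpa [mul_comm] using hint _ ((hD i).pow 2)
      · exact iA.add iB
      · have h1 : coordDeriv i U x ^ 2 ≤ ∑ j, coordDeriv j U x ^ 2 :=
          Finset.single_le_sum (f := fun j => coordDeriv j U x ^ 2) (fun j _ => sq_nonneg _)
            (Finset.mem_univ i)
        have h2 : 0 ≤ χ (x - y) := χ.nonneg
        have h3 := (hU.pos x)
        dsimp only
        nlinarith [mul_nonneg h2 (sub_nonneg.2 h1), mul_nonneg h2 (sq_nonneg (U x))]
    refine e2.trans ?_
    rw [integral_add iA iB, e1, ← integral_add (hlapint.const_mul _) iB]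
    refine integral_mono ((hlapint.const_mul _).add iB) ?_ fun x => ?_
    · exact (integrable_indicator_iff measurableSet_closedBall).2 (integrableOn_const
        measure_closedBall_lt_top.ne)
    dsimp only
    rw [lap_comp_sub y hχ2]
    by_cases hx : x ∈ Metric.closedBall y r
    · rw [Set.indicator_of_mem hx]
      have hxy : ‖x - y‖ ≤ r := by simpa [dist_eq_norm] using hx
      have hy : ‖y‖ ≤ ‖x‖ + r := by
        have := norm_sub_norm_le y x
        rw [norm_sub_rev] at this
        linarith
      have hb : |lap χ (x - y)| ≤ B := hB ⟨x - y, by simpa using hxy, rfl⟩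
      have h2 : U x * U x ≤ C ^ 2 * Real.exp (2 * r) * Real.exp (-(2 * ‖y‖)) := by
        calc U x * U x ≤ (C * Real.exp (-‖x‖)) * (C * Real.exp (-‖x‖)) :=
              mul_le_mul (hC x) (hC x) (hU.pos x).le (by positivity)
          _ = C ^ 2 * Real.exp (-(2 * ‖x‖)) := by
              rw [show -(2 * ‖x‖) = -‖x‖ + -‖x‖ by ring, Real.exp_add]; ring
          _ ≤ C ^ 2 * Real.exp (2 * r + -(2 * ‖y‖)) := by
              gcongr; linarith
          _ = _ := by rw [Real.exp_add]; ring
      have h3 : U x * U x ^ p ≤ C ^ (p - 1) * (U x * U x) := by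
        have h4 : U x ^ p = U x ^ (p - 1) * U x := by
          rw [← Real.rpow_add_one (hU.pos x).ne']; ring_nf
        have h5 : U x ^ (p - 1) ≤ C ^ (p - 1) := by
          refine Real.rpow_le_rpow (hU.pos x).le ((hC x).trans ?_) (by linarith)
          exact mul_le_of_le_one_right hC0.le (Real.exp_le_one_iff.2 (by simp))
        rw [h4]
        nlinarith [mul_nonneg (sub_nonneg.2 h5) (mul_nonneg (hU.pos x).le (hU.pos x).le)]
      have hUU : 0 ≤ U x * U x := mul_nonneg (hU.pos x).le (hU.pos x).le
      have h6 : 1 / 2 * (U x * U x * lap χ (x - y)) ≤ B * (U x * U x) := by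
        have := (le_abs_self _).trans hb
        nlinarith
      have h7 : U x * U x ^ p * χ (x - y) ≤ U x * U x ^ p :=
        mul_le_of_le_one_right (mul_nonneg (hU.pos x).le (Real.rpow_nonneg (hU.pos x).le _))
          χ.le_one
      calc _ ≤ (B + C ^ (p - 1)) * (U x * U x) := by linarith
        _ ≤ (B + C ^ (p - 1)) * (C ^ 2 * Real.exp (2 * r) * Real.exp (-(2 * ‖y‖))) := by gcongr
        _ = _ := by rw [hS]; ring
    · rw [Set.indicator_of_notMem hx]
      have hxy : r < ‖x - y‖ := by simpa [dist_eq_norm] using hx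
      rw [hlap0 _ hxy, χ.zero_of_le_dist (by simpa using hxy.le)]
      simp
  refine hone.trans_eq ?_
  rw [integral_indicator measurableSet_closedBall, setIntegral_const, hballvol]
  simp
  ring

lemma integrable_coordDeriv (hU : IsDecayingSolution p L₀ U) (hN : 2 ≤ N) (hp : 2 ≤ p)
    (i : Fin N) : Integrable (coordDeriv i U) := by
  set χ : ContDiffBump (0 : EuclideanSpace ℝ (Fin N)) := ⟨1, 2, one_pos, one_lt_two⟩ with hχ
  obtain ⟨K, hK⟩ := hU.integral_sq_coordDeriv_le hN hp i χ
  have hD : Continuous (coordDeriv i U) := continuous_coordDeriv i (hU.contDiff.of_le (by norm_num))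
  have hχc : Continuous (χ : EuclideanSpace ℝ (Fin N) → ℝ) := χ.continuous
  set I := ∫ x, χ x with hI
  have hχint : Integrable (χ : EuclideanSpace ℝ (Fin N) → ℝ) :=
    hχc.integrable_of_hasCompactSupport χ.hasCompactSupport
  have hI0 : 0 < I := hχc.integral_pos_of_hasCompactSupport_nonneg_nonzero χ.hasCompactSupport
    (fun x => χ.nonneg) (x := 0) (χ.pos_of_mem_ball (by simp [hχ])).ne'
  have hφc : ∀ y, HasCompactSupport (fun x => χ (x - y)) := fun y =>
    χ.hasCompactSupport.comp_homeomorph (Homeomorph.subRight y)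
  have hint : ∀ y, ∀ f : EuclideanSpace ℝ (Fin N) → ℝ, Continuous f →
      Integrable (fun x => χ (x - y) * f x) := fun y f hf =>
    ((hχc.comp (continuous_id.sub continuous_const)).mul hf).integrable_of_hasCompactSupport
      (hφc y).mul_right
  have hcont : Continuous fun z : EuclideanSpace ℝ (Fin N) × EuclideanSpace ℝ (Fin N) =>
      χ (z.2 - z.1) * |coordDeriv i U z.2| :=
    (hχc.comp (continuous_snd.sub continuous_fst)).mul (hD.comp continuous_snd).abs
  have hbound : ∀ y, ∫ x, χ (x - y) * |coordDeriv i U x| ≤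
      (1 / 2 * (K + I)) * Real.exp (-‖y‖) := fun y => by
    have hIy : ∫ x, χ (x - y) = I := integral_sub_right_eq_self (fun x => χ x) y
    calc ∫ x, χ (x - y) * |coordDeriv i U x|
        ≤ ∫ x, ((1 / 2 * Real.exp ‖y‖) * (χ (x - y) * coordDeriv i U x ^ 2) +
            (1 / 2 * Real.exp (-‖y‖)) * χ (x - y)) := by
          refine integral_mono (hint y _ hD.abs) (((hint y _ (hD.pow 2)).const_mul _).add
            ((hχint.comp_sub_right y).const_mul _)) fun x => ?_
          have h1 : 0 ≤ χ (x - y) := χ.nonneg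
          have h2 : |coordDeriv i U x| ≤
              1 / 2 * Real.exp ‖y‖ * coordDeriv i U x ^ 2 + 1 / 2 * Real.exp (-‖y‖) := by
            have h3 : Real.exp ‖y‖ * Real.exp (-‖y‖) = 1 := by rw [← Real.exp_add]; simp
            rw [← sq_abs (coordDeriv i U x)]
            have h4 := Real.exp_pos ‖y‖
            have h5 := Real.exp_pos (-‖y‖)
            have h6 : 0 ≤ Real.exp (-‖y‖) * (Real.exp ‖y‖ * |coordDeriv i U x| - 1) ^ 2 := by
              positivity
            have h7 : Real.exp (-‖y‖) * (Real.exp ‖y‖ * |coordDeriv i U x| - 1) ^ 2 =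
                (Real.exp ‖y‖ * Real.exp (-‖y‖)) *
                  (Real.exp ‖y‖ * |coordDeriv i U x| ^ 2 - 2 * |coordDeriv i U x|) +
                  Real.exp (-‖y‖) := by ring
            rw [h7, h3] at h6
            linarith
          have := mul_le_mul_of_nonneg_left h2 h1
          dsimp only
          linarith
      _ = (1 / 2 * Real.exp ‖y‖) * (∫ x, χ (x - y) * coordDeriv i U x ^ 2) +
            (1 / 2 * Real.exp (-‖y‖)) * I := by
          rw [integral_add ((hint y (fun x => coordDeriv i U x ^ 2) (hD.pow 2)).const_mul _)
            ((hχint.comp_sub_right y).const_mul _), integral_const_mul, integral_const_mul, hIy]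
      _ ≤ (1 / 2 * Real.exp ‖y‖) * (K * Real.exp (-(2 * ‖y‖))) +
            (1 / 2 * Real.exp (-‖y‖)) * I := by
          gcongr; exact hK y
      _ = _ := by
          rw [show -(2 * ‖y‖) = -‖y‖ + -‖y‖ by ring, Real.exp_add]
          have h3 : Real.exp ‖y‖ * Real.exp (-‖y‖) = 1 := by rw [← Real.exp_add]; simp
          linear_combination (1 / 2 * K * Real.exp (-‖y‖)) * h3
  have hprod : Integrable (fun z : EuclideanSpace ℝ (Fin N) × EuclideanSpace ℝ (Fin N) =>
      χ (z.2 - z.1) * |coordDeriv i U z.2|) (volume.prod volume) := by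
    rw [integrable_prod_iff hcont.aestronglyMeasurable]
    refine ⟨Eventually.of_forall fun y => hint y _ hD.abs, ?_⟩
    refine Integrable.mono' ((integrable_exp_neg_norm N).const_mul (1 / 2 * (K + I)))
      hcont.norm.aestronglyMeasurable.integral_prod_right' (Eventually.of_forall fun y => ?_)
    have h1 : ∀ x, ‖χ (x - y) * |coordDeriv i U x|‖ = χ (x - y) * |coordDeriv i U x| := fun x =>
      Real.norm_of_nonneg (mul_nonneg χ.nonneg (abs_nonneg _))
    simp_rw [h1]
    rw [Real.norm_of_nonneg (integral_nonneg fun x => mul_nonneg χ.nonneg (abs_nonneg _))]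
    exact hbound y
  have h := hprod.integral_prod_right
  have h2 : (fun x => ∫ y, χ (x - y) * |coordDeriv i U x|) = fun x => I * |coordDeriv i U x| := by
    funext x
    rw [integral_mul_const, integral_sub_left_eq_self (fun z => χ z) volume x]
  simp only [h2] at h
  refine (h.const_mul I⁻¹).mono' hD.aestronglyMeasurable (Eventually.of_forall fun x => ?_)
  rw [← mul_assoc, inv_mul_cancel₀ hI0.ne', one_mul, Real.norm_eq_abs]

end IsDecayingSolution

/-- Gaussian majorant of `exp (|x j| - ‖x‖)` on the ball of radius `2 * R`. -/
lemma exists_gaussian_majorant {N : ℕ} (j : Fin N) : ∃ C > 0, ∀ R : ℝ, 1 ≤ R →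
    ∃ G : EuclideanSpace ℝ (Fin N) → ℝ, Integrable G ∧ (∀ x, 0 ≤ G x) ∧
      (∀ x, ‖x‖ ≤ 2 * R → Real.exp (|x j| - ‖x‖) ≤ G x) ∧
      ∫ x, G x ≤ C * (R * R ^ (((N : ℝ) - 1) / 2)) := by
  have hN : 1 ≤ N := Nat.one_le_iff_ne_zero.2 fun h => by subst h; exact j.elim0
  refine ⟨Real.exp 1 * (√(4 * π) * (4 * π) ^ (((N : ℝ) - 1) / 2)), by positivity, fun R hR => ?_⟩
  have hR0 : 0 < R := by linarith
  set c : Fin N → ℝ := fun i => if i = j then 1 / (4 * R ^ 2) else 1 / (4 * R) with hc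
  set g : EuclideanSpace ℝ (Fin N) → ℝ := fun x => ∏ i, Real.exp (-c i * x i ^ 2) with hg
  have hint : ∫ x, g x = √(4 * π) * R * ((4 * π) ^ (((N : ℝ) - 1) / 2) *
      R ^ (((N : ℝ) - 1) / 2)) := by
    have h1 : ∫ x, g x = ∏ i, ∫ t : ℝ, Real.exp (-c i * t ^ 2) := by
      rw [← integral_fintype_prod_volume_eq_prod (fun i (t : ℝ) => Real.exp (-c i * t ^ 2)),
        ← (PiLp.volume_preserving_ofLp (Fin N)).integral_comp
          (MeasurableEquiv.toLp 2 (Fin N → ℝ)).symm.measurableEmbedding]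
    rw [h1]
    simp_rw [integral_gaussian]
    rw [← Finset.mul_prod_erase _ _ (Finset.mem_univ j)]
    congr 1
    · simp only [hc, if_true]
      rw [show π / (1 / (4 * R ^ 2)) = (4 * π) * R ^ 2 by field_simp, Real.sqrt_mul (by positivity),
        Real.sqrt_sq hR0.le]
    · rw [Finset.prod_congr rfl (g := fun _ => √(4 * π * R)) fun i hi => by
        simp only [hc, if_neg (Finset.ne_of_mem_erase hi)]
        congr 1
        field_simp]
      rw [Finset.prod_const, Finset.card_erase_of_mem (Finset.mem_univ j), Finset.card_univ,
        Fintype.card_fin, Real.sqrt_eq_rpow, ← Real.rpow_natCast, ← Real.rpow_mul (by positivity),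
        ← Real.mul_rpow (by positivity) hR0.le, Nat.cast_sub hN]
      congr 1
      push_cast
      ring
  have hgi : Integrable g := by
    refine not_imp_comm.1 integral_undef ?_
    rw [hint]
    positivity
  refine ⟨fun x => Real.exp 1 * g x, hgi.const_mul _, fun x => by positivity, fun x hx => ?_, ?_⟩
  · have hsum : ∑ i, c i * x i ^ 2 = x j ^ 2 / (4 * R ^ 2) + (‖x‖ ^ 2 - x j ^ 2) / (4 * R) := by
      rw [EuclideanSpace.norm_sq_eq, ← Finset.add_sum_erase _ _ (Finset.mem_univ j),
        ← Finset.add_sum_erase _ (fun i => ‖x i‖ ^ 2) (Finset.mem_univ j)]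
      simp only [hc, if_true, Real.norm_eq_abs, sq_abs, add_sub_cancel_left, Finset.sum_div]
      congr 1
      · ring
      · refine Finset.sum_congr rfl fun i hi => ?_
        rw [if_neg (Finset.ne_of_mem_erase hi)]
        ring
    simp only [hg, neg_mul]
    rw [← Real.exp_sum, ← Real.exp_add, Finset.sum_neg_distrib, hsum]
    refine Real.exp_le_exp.2 ?_
    have hxj : |x j| ≤ ‖x‖ := by simpa using PiLp.norm_apply_le x j
    have h1 : x j ^ 2 / (4 * R ^ 2) ≤ 1 := by
      rw [div_le_one (by positivity), ← sq_abs]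
      nlinarith [abs_nonneg (x j)]
    have h2 : (‖x‖ ^ 2 - x j ^ 2) / (4 * R) ≤ ‖x‖ - |x j| := by
      rw [div_le_iff₀ (by positivity), ← sq_abs (x j)]
      nlinarith [abs_nonneg (x j)]
    linarith
  · rw [integral_const_mul, hint]
    exact le_of_eq (by ring)

namespace IsDecayingSolution

variable {N : ℕ} {p L₀ : ℝ} {U : EuclideanSpace ℝ (Fin N) → ℝ}

lemma integrable_exp_norm_mul_rpow (hU : IsDecayingSolution p L₀ U) (hN : 2 ≤ N) (hp : 2 ≤ p) :
    Integrable fun x => Real.exp ‖x‖ * U x ^ p := by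
  obtain ⟨C, hC0, hC⟩ := hU.exists_decay hN
  refine ((integrable_exp_neg_norm N).const_mul (C ^ p)).mono'
    ((by fun_prop : Continuous fun x : EuclideanSpace ℝ (Fin N) => Real.exp ‖x‖).mul
      (hU.continuous_rpow p)).aestronglyMeasurable (Eventually.of_forall fun x => ?_)
  rw [Real.norm_of_nonneg (mul_nonneg (Real.exp_pos _).le (Real.rpow_nonneg (hU.pos x).le _))]
  calc Real.exp ‖x‖ * U x ^ p ≤ Real.exp ‖x‖ * (C ^ p * Real.exp (-(p * ‖x‖))) := by
        gcongr; exact hU.rpow_mul_exp_le hC0 hC (by linarith) x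
    _ = C ^ p * Real.exp (‖x‖ + -(p * ‖x‖)) := by rw [Real.exp_add]; ring
    _ ≤ C ^ p * Real.exp (-‖x‖) := by
        gcongr; nlinarith [norm_nonneg x]

lemma integrable_exp_norm_mul_rpow_mul_coordDeriv (hU : IsDecayingSolution p L₀ U) (hN : 2 ≤ N)
    (hp : 2 ≤ p) (j : Fin N) :
    Integrable fun x => Real.exp ‖x‖ * (U x ^ (p - 1) * |coordDeriv j U x|) := by
  obtain ⟨C, hC0, hC⟩ := hU.exists_decay hN
  have hD : Continuous (coordDeriv j U) := continuous_coordDeriv j (hU.contDiff.of_le (by norm_num))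
  refine ((hU.integrable_coordDeriv hN hp j).norm.const_mul (C ^ (p - 1))).mono'
    ((by fun_prop : Continuous fun x : EuclideanSpace ℝ (Fin N) => Real.exp ‖x‖).mul
      ((hU.continuous_rpow (p - 1)).mul hD.abs)).aestronglyMeasurable
      (Eventually.of_forall fun x => ?_)
  rw [Real.norm_of_nonneg (mul_nonneg (Real.exp_pos _).le
    (mul_nonneg (Real.rpow_nonneg (hU.pos x).le _) (abs_nonneg _))), Real.norm_eq_abs, ← mul_assoc]
  gcongr
  calc Real.exp ‖x‖ * U x ^ (p - 1)
      ≤ Real.exp ‖x‖ * (C ^ (p - 1) * Real.exp (-((p - 1) * ‖x‖))) := by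
        gcongr; exact hU.rpow_mul_exp_le hC0 hC (by linarith) x
    _ = C ^ (p - 1) * Real.exp (‖x‖ + -((p - 1) * ‖x‖)) := by rw [Real.exp_add]; ring
    _ ≤ C ^ (p - 1) * 1 := by
        gcongr; exact Real.exp_le_one_iff.2 (by nlinarith [norm_nonneg x])
    _ = _ := mul_one _

/-- The moment `∫ U ^ p * sinh (x j)` vanishes, since `U` has the same asymptotics in the
directions `e` and `-e`. -/
lemma integral_rpow_mul_sinh (hU : IsDecayingSolution p L₀ U) (hN : 2 ≤ N) (hp : 2 ≤ p)
    (j : Fin N) : ∫ x, U x ^ p * Real.sinh (x j) = 0 := by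
  set m : ℝ := ((N : ℝ) - 1) / 2 with hm
  have hm0 : 0 ≤ m := by
    have : (2 : ℝ) ≤ N := by exact_mod_cast hN
    rw [hm]; linarith
  set χ : ContDiffBump (0 : EuclideanSpace ℝ (Fin N)) := ⟨1, 2, one_pos, one_lt_two⟩ with hχ
  have hχ2 : ContDiff ℝ 2 (χ : EuclideanSpace ℝ (Fin N) → ℝ) := χ.contDiff
  have hlapc : Continuous (lap χ) := continuous_lap hχ2
  have hDc : Continuous (coordDeriv j χ) := continuous_coordDeriv j (hχ2.of_le (by norm_num))
  have hDcs : HasCompactSupport (coordDeriv j χ) := χ.hasCompactSupport.coordDeriv j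
  have hout : ∀ x : EuclideanSpace ℝ (Fin N), 2 < ‖x‖ → χ =ᶠ[𝓝 x] fun _ => (0 : ℝ) :=
    fun x hx => by
      filter_upwards [(isOpen_lt continuous_const continuous_norm).mem_nhds hx] with z hz
      exact χ.zero_of_le_dist (by simpa [hχ] using le_of_lt hz)
  have hin : ∀ x : EuclideanSpace ℝ (Fin N), ‖x‖ < 1 → χ =ᶠ[𝓝 x] fun _ => (1 : ℝ) :=
    fun x hx => χ.eventuallyEq_one_of_mem_ball (by simpa [hχ] using hx)
  have hlapcs : HasCompactSupport (lap χ) :=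
    HasCompactSupport.intro (isCompact_closedBall 0 2) fun x hx =>
      lap_eq_zero_of_eventuallyEq_const hχ2 (hout x (by simpa using hx))
  obtain ⟨B₁, hB₁⟩ := hDcs.exists_bound_of_continuous hDc
  obtain ⟨B₂, hB₂⟩ := hlapcs.exists_bound_of_continuous hlapc
  have hB₁0 : 0 ≤ B₁ := (norm_nonneg _).trans (hB₁ 0)
  have hB₂0 : 0 ≤ B₂ := (norm_nonneg _).trans (hB₂ 0)
  set B := 2 * B₁ + B₂ with hB
  have hneg : (fun x : EuclideanSpace ℝ (Fin N) => χ ((-1 : ℝ) • x)) = χ := by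
    funext x; rw [neg_one_smul, χ.neg]
  have hDodd : ∀ x, coordDeriv j χ (-x) = -coordDeriv j χ x := fun x => by
    have := congrFun (coordDeriv_comp_smul j (-1) (χ : EuclideanSpace ℝ (Fin N) → ℝ)) x
    rw [hneg] at this
    rw [this, neg_one_smul]; ring
  have hlapeven : ∀ x, lap χ (-x) = lap χ x := fun x => by
    have := lap_comp_smul (-1) hχ2 x
    rw [hneg] at this
    rw [this, neg_one_smul]; ring
  set s : EuclideanSpace ℝ (Fin N) → ℝ := fun x => Real.sinh (x j) with hs
  have hcoord : ContDiff ℝ 2 fun x : EuclideanSpace ℝ (Fin N) => x j :=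
    (EuclideanSpace.proj j : EuclideanSpace ℝ (Fin N) →L[ℝ] ℝ).contDiff
  have hs2 : ContDiff ℝ 2 s := Real.contDiff_sinh.comp hcoord
  have hDs : ∀ i, coordDeriv i s = fun x => if i = j then Real.cosh (x j) else 0 := fun i =>
    coordDeriv_comp_coord i j Real.hasDerivAt_sinh
  have hlaps : ∀ x, lap s x = s x := fun x => by
    rw [lap_eq_sum hs2, Finset.sum_eq_single j]
    · rw [hDs]
      simp only [if_true]
      rw [coordDeriv_comp_coord j j Real.hasDerivAt_cosh]
      simp [hs]
    · intro i _ hij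
      rw [hDs]
      simp [hij, coordDeriv]
    · simp
  set φ : ℝ → EuclideanSpace ℝ (Fin N) → ℝ := fun R x => s x * χ (R⁻¹ • x) with hφ
  set Ψ : ℝ → EuclideanSpace ℝ (Fin N) → ℝ := fun R x =>
    2 * (Real.cosh (x j) * (R⁻¹ * coordDeriv j χ (R⁻¹ • x))) + s x * (R⁻¹ ^ 2 * lap χ (R⁻¹ • x))
    with hΨ
  have hχR : ∀ R : ℝ, ContDiff ℝ 2 fun x : EuclideanSpace ℝ (Fin N) => χ (R⁻¹ • x) := fun R =>
    hχ2.comp (contDiff_const_smul _)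
  have hlapφ : ∀ R x, lap (φ R) x = φ R x + Ψ R x := fun R x => by
    simp only [hφ, hΨ]
    rw [lap_mul hs2 (hχR R), hlaps, lap_comp_smul _ hχ2, Finset.sum_eq_single j]
    · rw [coordDeriv_comp_smul, hDs]
      simp only [if_true]
      ring
    · intro i _ hij
      rw [hDs]
      simp [hij]
    · simp
  have hφcs : ∀ R : ℝ, 1 ≤ R → HasCompactSupport (φ R) := fun R hR =>
    HasCompactSupport.mul_left (χ.hasCompactSupport.comp_smul (inv_ne_zero (by linarith)))
  have hφ2 : ∀ R, ContDiff ℝ 2 (φ R) := fun R => hs2.mul (hχR R)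
  have hUc := hU.contDiff.continuous
  have hsmulc : ∀ R : ℝ, Continuous fun x : EuclideanSpace ℝ (Fin N) => R⁻¹ • x := fun R =>
    continuous_const_smul _
  have hΨc : ∀ R, Continuous (Ψ R) := fun R =>
    (((Real.continuous_cosh.comp hcoord.continuous).mul
      ((hDc.comp (hsmulc R)).const_mul R⁻¹)).const_mul 2).add
      (hs2.continuous.mul ((hlapc.comp (hsmulc R)).const_mul (R⁻¹ ^ 2)))
  have hΨout : ∀ R : ℝ, 1 ≤ R → ∀ x, 2 * R < ‖x‖ → Ψ R x = 0 := fun R hR x hx => by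
    have h1 : 2 < ‖R⁻¹ • x‖ := by
      rw [norm_smul, Real.norm_of_nonneg (by positivity), ← div_eq_inv_mul,
        lt_div_iff₀ (by linarith)]
      exact hx
    simp [hΨ, coordDeriv_eq_zero_of_eventuallyEq_const j (hout _ h1),
      lap_eq_zero_of_eventuallyEq_const hχ2 (hout _ h1)]
  have hΨin : ∀ R : ℝ, 1 ≤ R → ∀ x, ‖x‖ < R → Ψ R x = 0 := fun R hR x hx => by
    have h1 : ‖R⁻¹ • x‖ < 1 := by
      rw [norm_smul, Real.norm_of_nonneg (by positivity), ← div_eq_inv_mul,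
        div_lt_one (by linarith)]
      exact hx
    simp [hΨ, coordDeriv_eq_zero_of_eventuallyEq_const j (hin _ h1),
      lap_eq_zero_of_eventuallyEq_const hχ2 (hin _ h1)]
  have hΨcs : ∀ R : ℝ, 1 ≤ R → HasCompactSupport (Ψ R) := fun R hR =>
    HasCompactSupport.intro (isCompact_closedBall 0 (2 * R)) fun x hx =>
      hΨout R hR x (by simpa using hx)
  have hΨodd : ∀ R x, Ψ R (-x) = -Ψ R x := fun R x => by
    simp only [hΨ, hs, smul_neg, hDodd, hlapeven, PiLp.neg_apply, Real.sinh_neg, Real.cosh_neg]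
    ring
  have hcosh : ∀ t : ℝ, Real.cosh t ≤ Real.exp |t| := fun t => by
    rw [← Real.cosh_abs, Real.cosh_eq]
    have : Real.exp (-|t|) ≤ Real.exp |t| := Real.exp_le_exp.2 (by linarith [abs_nonneg t])
    linarith
  have hsinh : ∀ t : ℝ, |Real.sinh t| ≤ Real.exp |t| := fun t => by
    rw [Real.abs_sinh, Real.sinh_eq]
    have := Real.exp_pos (-|t|)
    have := Real.exp_pos |t|
    linarith
  have hΨb : ∀ R : ℝ, 1 ≤ R → ∀ x, |Ψ R x| ≤ B / R * Real.exp |x j| := fun R hR x => by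
    have hR0 : 0 < R := by linarith
    have hRi : R⁻¹ ^ 2 ≤ R⁻¹ := by
      have : R⁻¹ ≤ 1 := inv_le_one_of_one_le₀ hR
      have : 0 < R⁻¹ := by positivity
      nlinarith
    calc |Ψ R x| ≤ |2 * (Real.cosh (x j) * (R⁻¹ * coordDeriv j χ (R⁻¹ • x)))| +
          |s x * (R⁻¹ ^ 2 * lap χ (R⁻¹ • x))| := abs_add_le _ _
      _ = 2 * (Real.cosh (x j) * (R⁻¹ * |coordDeriv j χ (R⁻¹ • x)|)) +
          |s x| * (R⁻¹ ^ 2 * |lap χ (R⁻¹ • x)|) := by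
          simp only [abs_mul, abs_of_pos (Real.cosh_pos _), abs_pow, abs_two,
            abs_of_pos (inv_pos.2 hR0)]
      _ ≤ 2 * (Real.exp |x j| * (R⁻¹ * B₁)) + Real.exp |x j| * (R⁻¹ * B₂) := by
          gcongr
          · exact hcosh _
          · exact hB₁ _
          · exact hsinh _
          · exact hB₂ _
      _ = _ := by rw [hB]; ring
  have hgreen : ∀ R : ℝ, 1 ≤ R →
      2 * ∫ x, U x ^ p * φ R x = -∫ x, (U x - U (-x)) * Ψ R x := fun R hR => by
    have h1 := integral_mul_lap hU.contDiff (hφ2 R) (hφcs R hR)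
    simp_rw [hlapφ, hU.lap_eq] at h1
    have iφ : ∀ f : EuclideanSpace ℝ (Fin N) → ℝ, Continuous f → Integrable fun x => f x * φ R x :=
      fun f hf => (hf.mul (hφ2 R).continuous).integrable_of_hasCompactSupport (hφcs R hR).mul_left
    have iΨ : ∀ f : EuclideanSpace ℝ (Fin N) → ℝ, Continuous f → Integrable fun x => f x * Ψ R x :=
      fun f hf => (hf.mul (hΨc R)).integrable_of_hasCompactSupport (hΨcs R hR).mul_left
    simp_rw [mul_add, sub_mul] at h1
    rw [integral_add (iφ _ hUc) (iΨ _ hUc), integral_sub (iφ _ hUc) (iφ _ (hU.continuous_rpow p))]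
      at h1
    have h2 : ∫ x, U (-x) * Ψ R x = -∫ x, U x * Ψ R x := by
      rw [← integral_neg_eq_self (fun x => U (-x) * Ψ R x), ← integral_neg]
      congr 1; funext x
      rw [neg_neg, hΨodd]; ring
    simp_rw [sub_mul]
    rw [integral_sub (iΨ _ hUc) (iΨ (fun x => U (-x)) (hUc.comp continuous_neg)), h2]
    linarith
  have hlim : Tendsto (fun R : ℝ => ∫ x, U x ^ p * φ R x) atTop
      (𝓝 (∫ x, U x ^ p * Real.sinh (x j))) := by
    refine tendsto_integral_filter_of_dominated_convergence (fun x => Real.exp ‖x‖ * U x ^ p)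
      (Eventually.of_forall fun R =>
        ((hU.continuous_rpow p).mul (hφ2 R).continuous).aestronglyMeasurable)
      (Eventually.of_forall fun R => Eventually.of_forall fun x => ?_)
      (hU.integrable_exp_norm_mul_rpow hN hp) (Eventually.of_forall fun x => ?_)
    · have hxj : |x j| ≤ ‖x‖ := by simpa using PiLp.norm_apply_le x j
      rw [norm_mul, Real.norm_of_nonneg (Real.rpow_nonneg (hU.pos x).le _), mul_comm]
      refine mul_le_mul_of_nonneg_right ?_ (Real.rpow_nonneg (hU.pos x).le _)
      simp only [hφ, norm_mul, Real.norm_eq_abs, abs_of_nonneg χ.nonneg]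
      exact (mul_le_of_le_one_right (abs_nonneg _) χ.le_one).trans
        ((hsinh _).trans (Real.exp_le_exp.2 hxj))
    · refine tendsto_const_nhds.congr' ?_
      filter_upwards [eventually_ge_atTop (max 1 ‖x‖)] with R hR
      have hR0 : 0 < R := by linarith [le_max_left 1 ‖x‖]
      have : χ (R⁻¹ • x) = 1 := χ.one_of_mem_closedBall (by
        simp only [hχ, mem_closedBall_zero_iff, norm_smul, norm_inv, Real.norm_of_nonneg hR0.le]
        rw [← div_eq_inv_mul, div_le_one hR0]
        exact (le_max_right _ _).trans hR)
      simp [hφ, hs, this]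
  obtain ⟨C, hC0, hG⟩ := exists_gaussian_majorant j
  have hsmall : ∀ δ : ℝ, 0 < δ → |∫ x, U x ^ p * Real.sinh (x j)| ≤ δ * (B * C) := fun δ hδ => by
    have hB0 : 0 ≤ B := by positivity
    obtain ⟨R₀, hR₀⟩ := eventually_norm_comap
      (hU.tendsto.eventually (Metric.ball_mem_nhds L₀ hδ))
    refine le_of_tendsto hlim.abs ?_
    filter_upwards [eventually_ge_atTop (max 1 R₀)] with R hR
    have hR1 : 1 ≤ R := (le_max_left _ _).trans hR
    have hR0 : 0 < R := by linarith
    obtain ⟨G, hGi, hG0, hGb, hGint⟩ := hG R hR1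
    have hpt : ∀ x, ‖(U x - U (-x)) * Ψ R x‖ ≤ 2 * δ * (B / R) * (R ^ m)⁻¹ * G x := fun x => by
      by_cases hx1 : ‖x‖ < R
      · rw [hΨin R hR1 x hx1, mul_zero, norm_zero]
        have := hG0 x
        positivity
      by_cases hx2 : 2 * R < ‖x‖
      · rw [hΨout R hR1 x hx2, mul_zero, norm_zero]
        have := hG0 x
        positivity
      push Not at hx1 hx2
      have hx0 : 0 < ‖x‖ := by linarith
      have hdiff : |U x - U (-x)| ≤ 2 * δ * ((R ^ m)⁻¹ * Real.exp (-‖x‖)) := by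
        have h1 := hR₀ x (by linarith [le_max_right 1 R₀])
        have h2 := hR₀ (-x) (by rw [norm_neg]; linarith [le_max_right 1 R₀])
        rw [Real.dist_eq] at h1 h2
        rw [norm_neg] at h2
        have h3 : ‖x‖ ^ m * Real.exp ‖x‖ * |U x - U (-x)| ≤ 2 * δ := by
          rw [← abs_of_pos (show 0 < ‖x‖ ^ m * Real.exp ‖x‖ by positivity), ← abs_mul, abs_le]
          rw [abs_lt] at h1 h2
          constructor <;> linarith [h1.1, h1.2, h2.1, h2.2]
        have h4 : R ^ m * Real.exp ‖x‖ * |U x - U (-x)| ≤ 2 * δ :=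
          le_trans (by gcongr) h3
        rw [Real.exp_neg, ← mul_inv, ← div_eq_mul_inv, le_div_iff₀ (by positivity)]
        linarith
      rw [norm_mul, Real.norm_eq_abs, Real.norm_eq_abs]
      calc |U x - U (-x)| * |Ψ R x|
          ≤ 2 * δ * ((R ^ m)⁻¹ * Real.exp (-‖x‖)) * (B / R * Real.exp |x j|) :=
            mul_le_mul hdiff (hΨb R hR1 x) (abs_nonneg _) (by positivity)
        _ = 2 * δ * (B / R) * (R ^ m)⁻¹ * Real.exp (|x j| - ‖x‖) := by
            rw [sub_eq_add_neg, Real.exp_add]; ring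
        _ ≤ _ := by gcongr; exact hGb x hx2
    have h1 := norm_integral_le_of_norm_le (hGi.const_mul (2 * δ * (B / R) * (R ^ m)⁻¹))
      (Eventually.of_forall hpt)
    rw [integral_const_mul, Real.norm_eq_abs, ← abs_neg, ← hgreen R hR1, abs_mul, abs_two] at h1
    have h2 : 2 * δ * (B / R) * (R ^ m)⁻¹ * ∫ x, G x ≤
        2 * δ * (B / R) * (R ^ m)⁻¹ * (C * (R * R ^ m)) := by gcongr
    have h3 : 2 * δ * (B / R) * (R ^ m)⁻¹ * (C * (R * R ^ m)) = 2 * (δ * (B * C)) := by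
      have : R ^ m ≠ 0 := (Real.rpow_pos_of_pos hR0 _).ne'
      field_simp
    linarith
  have hlim0 : Tendsto (fun δ : ℝ => δ * (B * C)) (𝓝[>] 0) (𝓝 0) := by
    have : Tendsto (fun δ : ℝ => δ * (B * C)) (𝓝 0) (𝓝 (0 * (B * C))) :=
      (continuous_id.mul continuous_const).tendsto 0
    rw [zero_mul] at this
    exact this.mono_left nhdsWithin_le_nhds
  have := ge_of_tendsto hlim0 (eventually_nhdsWithin_of_forall fun δ hδ => hsmall δ hδ)
  exact abs_eq_zero.1 (le_antisymm this (abs_nonneg _))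

end IsDecayingSolution

namespace IsDecayingSolution

variable {N : ℕ} {p L₀ : ℝ} {U : EuclideanSpace ℝ (Fin N) → ℝ}

lemma integral_rpow_mul_coordDeriv_mul_exp (hU : IsDecayingSolution p L₀ U) (hN : 2 ≤ N)
    (hp : 2 ≤ p) (j : Fin N) {c : ℝ} (hc : |c| ≤ 1) :
    p * ∫ x, U x ^ (p - 1) * coordDeriv j U x * Real.exp (c * x j) =
      -(c * ∫ x, U x ^ p * Real.exp (c * x j)) := by
  have hU1 : Differentiable ℝ U := hU.contDiff.differentiable (by norm_num)
  have hD : Continuous (coordDeriv j U) := continuous_coordDeriv j (hU.contDiff.of_le (by norm_num))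
  have hcoord : ContDiff ℝ 2 fun x : EuclideanSpace ℝ (Fin N) => x j :=
    (EuclideanSpace.proj j : EuclideanSpace ℝ (Fin N) →L[ℝ] ℝ).contDiff
  have hexp : ∀ x : EuclideanSpace ℝ (Fin N), Real.exp (c * x j) ≤ Real.exp ‖x‖ := fun x => by
    refine Real.exp_le_exp.2 ((le_abs_self _).trans ?_)
    rw [abs_mul]
    have hxj : |x j| ≤ ‖x‖ := by simpa using PiLp.norm_apply_le x j
    nlinarith [abs_nonneg (x j), abs_nonneg c]
  have hec : Continuous fun x : EuclideanSpace ℝ (Fin N) => Real.exp (c * x j) :=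
    Real.continuous_exp.comp (hcoord.continuous.const_mul c)
  have i1 : Integrable fun x => U x ^ p * Real.exp (c * x j) := by
    refine (hU.integrable_exp_norm_mul_rpow hN hp).mono'
      ((hU.continuous_rpow p).mul hec).aestronglyMeasurable (Eventually.of_forall fun x => ?_)
    have := Real.rpow_nonneg (hU.pos x).le p
    rw [Real.norm_of_nonneg (by positivity), mul_comm]
    gcongr
    exact Real.exp_le_exp.1 (hexp x)
  have i2 : Integrable fun x => U x ^ (p - 1) * coordDeriv j U x * Real.exp (c * x j) := by
    refine (hU.integrable_exp_norm_mul_rpow_mul_coordDeriv hN hp j).mono'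
      (((hU.continuous_rpow (p - 1)).mul hD).mul hec).aestronglyMeasurable
      (Eventually.of_forall fun x => ?_)
    have := Real.rpow_nonneg (hU.pos x).le (p - 1)
    rw [norm_mul, norm_mul, Real.norm_of_nonneg this, Real.norm_of_nonneg (Real.exp_pos _).le,
      mul_comm, Real.norm_eq_abs]
    gcongr
    exact Real.exp_le_exp.1 (hexp x)
  have hdp : ∀ x, HasFDerivAt (fun x => U x ^ p) ((p * U x ^ (p - 1)) • fderiv ℝ U x) x :=
    fun x => (hU1 x).hasFDerivAt.rpow_const (Or.inl (hU.pos x).ne')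
  have hde : ∀ x : EuclideanSpace ℝ (Fin N), HasFDerivAt (fun x : EuclideanSpace ℝ (Fin N) =>
      Real.exp (c * x j)) ((c * Real.exp (c * x j)) •
        (EuclideanSpace.proj j : EuclideanSpace ℝ (Fin N) →L[ℝ] ℝ)) x := fun x => by
    have h1 := ((EuclideanSpace.proj j : EuclideanSpace ℝ (Fin N) →L[ℝ] ℝ).hasFDerivAt
      (x := x)).const_mul c
    have h2 := h1.exp
    rw [smul_smul, mul_comm] at h2
    exact h2
  have e1 : ∀ x, fderiv ℝ (fun x => U x ^ p) x (EuclideanSpace.single j 1) =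
      p * (U x ^ (p - 1) * coordDeriv j U x) := fun x => by
    rw [(hdp x).fderiv]
    simp only [coordDeriv, smul_apply, smul_eq_mul]
    ring
  have e2 : ∀ x : EuclideanSpace ℝ (Fin N), fderiv ℝ (fun x : EuclideanSpace ℝ (Fin N) =>
      Real.exp (c * x j)) x (EuclideanSpace.single j 1) = c * Real.exp (c * x j) := fun x => by
    rw [(hde x).fderiv]
    simp
  have key := integral_mul_fderiv_eq_neg_fderiv_mul_of_integrable (μ := volume) (𝕜 := ℝ)
    (f := fun x => U x ^ p) (g := fun x : EuclideanSpace ℝ (Fin N) => Real.exp (c * x j))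
    (v := EuclideanSpace.single j 1) ?_ ?_ i1 (fun x _ => (hdp x).differentiableAt)
    (fun x _ => (hde x).differentiableAt)
  · simp_rw [e1, e2] at key
    have k1 : ∫ x, U x ^ p * (c * Real.exp (c * x j)) =
        c * ∫ x, U x ^ p * Real.exp (c * x j) := by
      rw [← integral_const_mul]; congr 1; funext x; ring
    have k2 : ∫ x, p * (U x ^ (p - 1) * coordDeriv j U x) * Real.exp (c * x j) =
        p * ∫ x, U x ^ (p - 1) * coordDeriv j U x * Real.exp (c * x j) := by
      rw [← integral_const_mul]; congr 1; funext x; ring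
    rw [k1, k2] at key
    linarith
  · simp_rw [e1]
    exact (i2.const_mul p).congr (Eventually.of_forall fun x => by dsimp only; ring)
  · simp_rw [e2]
    exact (i1.const_mul c).congr (Eventually.of_forall fun x => by dsimp only; ring)

/-- The two exponential moments of `U ^ (p - 1) * ∂_j U` are opposite and nonzero. -/
lemma exists_moment (hU : IsDecayingSolution p L₀ U) (hN : 2 ≤ N) (hp : 2 ≤ p) (j : Fin N) :
    ∃ A > 0, ∫ x, U x ^ (p - 1) * coordDeriv j U x * Real.exp (x j) = -A ∧
      ∫ x, U x ^ (p - 1) * coordDeriv j U x * Real.exp (-x j) = A := by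
  have hcoord : Continuous fun x : EuclideanSpace ℝ (Fin N) => x j :=
    (EuclideanSpace.proj j : EuclideanSpace ℝ (Fin N) →L[ℝ] ℝ).continuous
  have hint : ∀ h : ℝ → ℝ, Continuous h → (∀ t, |h t| ≤ Real.exp |t|) →
      Integrable fun x => U x ^ p * h (x j) := fun h hc hb => by
    refine (hU.integrable_exp_norm_mul_rpow hN hp).mono'
      ((hU.continuous_rpow p).mul (hc.comp hcoord)).aestronglyMeasurable
      (Eventually.of_forall fun x => ?_)
    have hxj : |x j| ≤ ‖x‖ := by simpa using PiLp.norm_apply_le x j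
    rw [norm_mul, Real.norm_of_nonneg (Real.rpow_nonneg (hU.pos x).le p), mul_comm]
    exact mul_le_mul_of_nonneg_right ((hb _).trans (Real.exp_le_exp.2 hxj))
      (Real.rpow_nonneg (hU.pos x).le p)
  have icosh := hint Real.cosh Real.continuous_cosh fun t => by
    rw [abs_of_pos (Real.cosh_pos t), ← Real.cosh_abs, Real.cosh_eq]
    have : Real.exp (-|t|) ≤ Real.exp |t| := Real.exp_le_exp.2 (by linarith [abs_nonneg t])
    linarith
  have isinh := hint Real.sinh Real.continuous_sinh fun t => by
    rw [Real.abs_sinh, Real.sinh_eq]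
    have := Real.exp_pos (-|t|)
    have := Real.exp_pos |t|
    linarith
  have h0 := hU.integral_rpow_mul_sinh hN hp j
  set A := ∫ x, U x ^ p * Real.cosh (x j) with hA
  have hpos : ∀ x, 0 < U x ^ p * Real.cosh (x j) := fun x =>
    mul_pos (Real.rpow_pos_of_pos (hU.pos x) p) (Real.cosh_pos _)
  have hA0 : 0 < A := by
    refine (integral_pos_iff_support_of_nonneg (fun x => (hpos x).le) icosh).2 ?_
    rw [show Function.support _ = Set.univ from Set.eq_univ_of_forall fun x => (hpos x).ne']
    exact isOpen_univ.measure_pos volume Set.univ_nonempty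
  have h1 : ∫ x, U x ^ p * Real.exp (1 * x j) = A := by
    simp_rw [one_mul, ← Real.cosh_add_sinh, mul_add]
    rw [integral_add icosh isinh, h0, add_zero]
  have h2 : ∫ x, U x ^ p * Real.exp (-1 * x j) = A := by
    simp_rw [neg_one_mul, ← Real.cosh_sub_sinh, mul_sub]
    rw [integral_sub icosh isinh, h0, sub_zero]
  have m1 := hU.integral_rpow_mul_coordDeriv_mul_exp hN hp j (c := 1) (by simp)
  have m2 := hU.integral_rpow_mul_coordDeriv_mul_exp hN hp j (c := -1) (by simp)
  rw [h1] at m1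
  rw [h2] at m2
  simp only [one_mul, neg_one_mul, neg_neg] at m1 m2
  have hp0 : 0 < p := by linarith
  refine ⟨A / p, by positivity, ?_, ?_⟩
  · rw [← neg_div, eq_div_iff hp0.ne', mul_comm]; exact m1
  · rw [eq_div_iff hp0.ne', mul_comm]; exact m2

end IsDecayingSolution

/-- The decay profile `e^{-s} s^{-(N-1)/2}` of the ground state on `ℝ^N`. -/
noncomputable def decayProfile (N : ℕ) (s : ℝ) : ℝ :=
  Real.exp (-s) * s ^ (-(((N : ℝ) - 1) / 2))

lemma decayProfile_pos {N : ℕ} {s : ℝ} (hs : 0 < s) : 0 < decayProfile N s :=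
  mul_pos (Real.exp_pos _) (Real.rpow_pos_of_pos hs _)

lemma decayProfile_le {N : ℕ} (hN : 1 ≤ N) {s t : ℝ} (hs : 0 < s) (hst : s ≤ t) :
    decayProfile N t ≤ Real.exp (-(t - s)) * decayProfile N s := by
  have hN' : (1 : ℝ) ≤ N := by exact_mod_cast hN
  have h : t ^ (-(((N : ℝ) - 1) / 2)) ≤ s ^ (-(((N : ℝ) - 1) / 2)) :=
    Real.rpow_le_rpow_of_nonpos hs hst (by linarith)
  calc decayProfile N t ≤ Real.exp (-t) * s ^ (-(((N : ℝ) - 1) / 2)) := by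
        unfold decayProfile; gcongr
    _ = _ := by
        unfold decayProfile
        rw [← mul_assoc, ← Real.exp_add]
        ring_nf

lemma decayProfile_div_le {N : ℕ} (hN : 1 ≤ N) {s t : ℝ} (hs : 0 < s) (hst : s ≤ t) :
    decayProfile N t / decayProfile N s ≤ Real.exp (-(t - s)) :=
  (div_le_iff₀ (decayProfile_pos hs)).2 (decayProfile_le hN hs hst)

lemma abs_norm_sub_smul_sub_le {E : Type*} [NormedAddCommGroup E] [NormedSpace ℝ E] {v : E}
    (hv : ‖v‖ = 1) (x : E) {s : ℝ} (hs : 0 ≤ s) : |‖x - s • v‖ - s| ≤ ‖x‖ := by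
  have h1 : ‖s • v‖ = s := by rw [norm_smul, hv, mul_one, Real.norm_of_nonneg hs]
  have h2 := abs_norm_sub_norm_le (x - s • v) (-(s • v))
  rwa [norm_neg, h1, sub_neg_eq_add, sub_add_cancel] at h2

lemma tendsto_norm_sub_smul_div {E : Type*} [NormedAddCommGroup E] [NormedSpace ℝ E] {v : E}
    (hv : ‖v‖ = 1) (x : E) : Tendsto (fun s : ℝ => ‖x - s • v‖ / s) atTop (𝓝 1) := by
  rw [tendsto_iff_norm_sub_tendsto_zero]
  refine squeeze_zero' (Eventually.of_forall fun _ => norm_nonneg _) ?_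
    (tendsto_const_nhds.div_atTop tendsto_id : Tendsto (fun s : ℝ => ‖x‖ / id s) atTop (𝓝 0))
  filter_upwards [eventually_gt_atTop 0] with s hs
  rw [div_sub_one hs.ne', norm_div, Real.norm_of_nonneg hs.le, Real.norm_eq_abs]
  exact div_le_div_of_nonneg_right (abs_norm_sub_smul_sub_le hv x hs.le) hs.le

lemma tendsto_norm_sub_smul_sub {E : Type*} [NormedAddCommGroup E] [InnerProductSpace ℝ E]
    {v : E} (hv : ‖v‖ = 1) (x : E) :
    Tendsto (fun s : ℝ => ‖x - s • v‖ - s) atTop (𝓝 (-inner ℝ x v)) := by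
  have h1 : Tendsto (fun s : ℝ => (‖x‖ ^ 2 / s - 2 * inner ℝ x v) / (‖x - s • v‖ / s + 1))
      atTop (𝓝 ((0 - 2 * inner ℝ x v) / (1 + 1))) :=
    ((tendsto_const_nhds.div_atTop tendsto_id).sub tendsto_const_nhds).div
      ((tendsto_norm_sub_smul_div hv x).add tendsto_const_nhds) (by norm_num)
  rw [show (0 - 2 * inner ℝ x v) / (1 + 1) = -inner ℝ x v by ring] at h1
  refine h1.congr' ?_
  filter_upwards [eventually_gt_atTop 0] with s hs
  have h2 : ‖x - s • v‖ ^ 2 = ‖x‖ ^ 2 - 2 * (s * inner ℝ x v) + s ^ 2 := by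
    rw [norm_sub_sq_real, real_inner_smul_right, norm_smul, hv, Real.norm_of_nonneg hs.le, mul_one]
  have h3 : 0 < ‖x - s • v‖ + s := by positivity
  rw [div_sub' hs.ne', div_add_one hs.ne', div_div_div_cancel_right₀ hs.ne', div_eq_iff h3.ne']
  linarith

namespace IsDecayingSolution

variable {N : ℕ} {p L₀ : ℝ} {U : EuclideanSpace ℝ (Fin N) → ℝ}

lemma tendsto_sub_smul_div (hU : IsDecayingSolution p L₀ U) {v : EuclideanSpace ℝ (Fin N)}
    (hv : ‖v‖ = 1) (x : EuclideanSpace ℝ (Fin N)) :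
    Tendsto (fun s : ℝ => U (x - s • v) / decayProfile N s) atTop
      (𝓝 (L₀ * Real.exp (inner ℝ x v))) := by
  have hn : Tendsto (fun s : ℝ => ‖x - s • v‖) atTop atTop := by
    refine tendsto_atTop_mono' _ ?_ (tendsto_atTop_add_const_right _ (-‖x‖) tendsto_id)
    filter_upwards [eventually_ge_atTop 0] with s hs
    have := (abs_le.1 (abs_norm_sub_smul_sub_le hv x hs)).1
    simp only [id]
    linarith
  have h1 := hU.tendsto.comp (tendsto_comap_iff.2 hn : Tendsto (fun s : ℝ => x - s • v) atTop _)
  have h2 : Tendsto (fun s : ℝ => Real.exp (-(‖x - s • v‖ - s))) atTop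
      (𝓝 (Real.exp (- -inner ℝ x v))) :=
    (Real.continuous_exp.tendsto _).comp (tendsto_norm_sub_smul_sub hv x).neg
  have h3 : Tendsto (fun s : ℝ => (‖x - s • v‖ / s) ^ (-(((N : ℝ) - 1) / 2))) atTop
      (𝓝 (1 ^ (-(((N : ℝ) - 1) / 2)))) :=
    (tendsto_norm_sub_smul_div hv x).rpow_const (Or.inl one_ne_zero)
  have h4 := (h1.mul h2).mul h3
  rw [neg_neg, Real.one_rpow, mul_one] at h4
  refine h4.congr' ?_
  filter_upwards [eventually_gt_atTop 0, hn.eventually_gt_atTop 0] with s hs hy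
  simp only [Function.comp, decayProfile]
  rw [Real.div_rpow hy.le hs.le, eq_div_iff (by positivity), Real.rpow_neg hy.le,
    Real.rpow_neg hs.le, neg_sub, Real.exp_sub, Real.exp_neg]
  have e1 := (Real.rpow_pos_of_pos hy (((N : ℝ) - 1) / 2)).ne'
  have e2 := (Real.rpow_pos_of_pos hs (((N : ℝ) - 1) / 2)).ne'
  have e3 := (Real.exp_pos s).ne'
  have e4 := (Real.exp_pos ‖x - s • v‖).ne'
  field_simp

/-- Uniform bound on a translate whose centre is not too close to the point. -/
lemma exists_translate_le (hU : IsDecayingSolution p L₀ U) (hN : 2 ≤ N) :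
    ∃ C > 0, ∀ (v x : EuclideanSpace ℝ (Fin N)) (b : ℝ), ‖v‖ = 1 → b ≠ 0 →
      |b| ≤ 2 * ‖x - b • v‖ → U (x - b • v) ≤ C * Real.exp ‖x‖ * decayProfile N |b| := by
  obtain ⟨C, hC, h⟩ := hU.exists_decay_rpow hN
  refine ⟨C * 2 ^ (((N : ℝ) - 1) / 2), by positivity, fun v x b hv hb hxb => ?_⟩
  have hb' : 0 < |b| := abs_pos.2 hb
  have hN' : (2 : ℝ) ≤ N := by exact_mod_cast hN
  have hm : 0 ≤ ((N : ℝ) - 1) / 2 := by linarith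
  set y := x - b • v with hy
  have hy0 : 0 < ‖y‖ := by linarith
  have h1 : |b| - ‖x‖ ≤ ‖y‖ := by
    have := norm_sub_norm_le (b • v) x
    rwa [norm_smul, hv, mul_one, Real.norm_eq_abs, norm_sub_rev] at this
  have h2 : (|b| / 2) ^ (((N : ℝ) - 1) / 2) ≤ ‖y‖ ^ (((N : ℝ) - 1) / 2) :=
    Real.rpow_le_rpow (by positivity) (by linarith) hm
  have h3 : Real.exp (|b| - ‖x‖) ≤ Real.exp ‖y‖ := Real.exp_le_exp.2 h1
  have h4 : (|b| / 2) ^ (((N : ℝ) - 1) / 2) * Real.exp (|b| - ‖x‖) * U y ≤ C :=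
    le_trans (by have := hU.pos y; gcongr) (h y)
  rw [Real.div_rpow hb'.le zero_le_two, Real.exp_sub] at h4
  rw [decayProfile, Real.rpow_neg hb'.le, Real.exp_neg]
  have e1 : 0 < |b| ^ (((N : ℝ) - 1) / 2) := Real.rpow_pos_of_pos hb' _
  have e2 : (0 : ℝ) < 2 ^ (((N : ℝ) - 1) / 2) := by positivity
  have e3 := Real.exp_pos |b|
  have e4 := Real.exp_pos ‖x‖
  calc U y = (|b| ^ (((N : ℝ) - 1) / 2) / 2 ^ (((N : ℝ) - 1) / 2) *
        (Real.exp |b| / Real.exp ‖x‖) * U y) * (2 ^ (((N : ℝ) - 1) / 2) * Real.exp ‖x‖ *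
        ((Real.exp |b|)⁻¹ * (|b| ^ (((N : ℝ) - 1) / 2))⁻¹)) := by field_simp
    _ ≤ C * (2 ^ (((N : ℝ) - 1) / 2) * Real.exp ‖x‖ *
        ((Real.exp |b|)⁻¹ * (|b| ^ (((N : ℝ) - 1) / 2))⁻¹)) := by gcongr
    _ = _ := by ring

end IsDecayingSolution

lemma summable_exp_neg_natAbs : Summable fun n : ℤ => Real.exp (-(n.natAbs : ℝ)) := by
  rw [summable_int_iff_summable_nat_and_neg]
  simpa using Real.summable_exp_neg_nat

/-- Points of a sequence with all consecutive gaps at least `s`. -/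
lemma mul_natAbs_le_abs_of_gap {b : ℤ → ℝ} {s : ℝ} (h0 : b 0 = 0)
    (hb : ∀ n, s ≤ b (n + 1) - b n) (n : ℤ) : s * n.natAbs ≤ |b n| := by
  have h1 : ∀ n : ℕ, s * n ≤ b n ∧ s * n ≤ -b (-n) := fun n => by
    induction n with
    | zero => simp [h0]
    | succ n ih =>
      have e1 := hb n
      have e2 := hb (-((n : ℤ) + 1))
      rw [neg_add, neg_add_cancel_right, ← neg_add] at e2
      push_cast
      constructor <;> linarith [ih.1, ih.2]
  rcases Int.natAbs_eq n with h | h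
  · have := (h1 n.natAbs).1
    rw [← h] at this
    exact this.trans (le_abs_self _)
  · have := (h1 n.natAbs).2
    rw [← h] at this
    exact this.trans (neg_le_abs _)

namespace IsDecayingSolution

variable {N : ℕ} {p L₀ : ℝ} {U : EuclideanSpace ℝ (Fin N) → ℝ}

/-- Translates centred at a well separated sequence, at points not much closer to the `n`-th
centre than the latter is to the origin. -/
lemma exists_translate_div_le (hU : IsDecayingSolution p L₀ U) (hN : 2 ≤ N) :
    ∃ C > 0, ∀ (v x : EuclideanSpace ℝ (Fin N)) (b w : ℤ → ℝ) (s : ℝ), ‖v‖ = 1 → 1 ≤ s →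
      (∀ n, s * n.natAbs ≤ |b n|) → w 0 = 0 → (∀ n, |w n| ≤ 1) →
      (∀ n, n ≠ 0 → |b n| ≤ 2 * ‖x - b n • v‖) → ∀ n : ℤ,
        |w n * U (x - b n • v) / decayProfile N s| ≤
          C * Real.exp ‖x‖ * Real.exp (-(s * ((n.natAbs : ℝ) - 1))) := by
  obtain ⟨C, hC, h⟩ := hU.exists_translate_le hN
  refine ⟨C, hC, fun v x b w s hv hs hb hw0 hw hx n => ?_⟩
  rcases eq_or_ne n 0 with rfl | hn
  · simp only [hw0, zero_mul, zero_div, abs_zero]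
    positivity
  have hn1 : (1 : ℝ) ≤ n.natAbs := by exact_mod_cast Int.natAbs_pos.2 hn
  have hs0 : 0 < s := by linarith
  have hsb : s ≤ |b n| := le_trans (by nlinarith) (hb n)
  have hF := decayProfile_pos (N := N) hs0
  have h1 := h v x (b n) hv (fun h0 => by rw [h0, abs_zero] at hsb; linarith) (hx n hn)
  have h2 : decayProfile N |b n| / decayProfile N s ≤
      Real.exp (-(s * ((n.natAbs : ℝ) - 1))) :=
    (decayProfile_div_le (by omega) hs0 hsb).trans (Real.exp_le_exp.2 (by nlinarith [hb n]))
  rw [abs_div, abs_mul, abs_of_pos (hU.pos _), abs_of_pos hF]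
  calc |w n| * U (x - b n • v) / decayProfile N s
      ≤ 1 * (C * Real.exp ‖x‖ * decayProfile N |b n|) / decayProfile N s := by
        have := hU.pos (x - b n • v)
        gcongr
        exact hw n
    _ = C * Real.exp ‖x‖ * (decayProfile N |b n| / decayProfile N s) := by ring
    _ ≤ _ := by gcongr

/-- To leading order a sum of translates centred at a well separated sequence is given by the two
nearest centres. -/
lemma tendsto_tsum_translate (hU : IsDecayingSolution p L₀ U) (hN : 2 ≤ N) (j : Fin N)
    {l : Filter ℝ} {b : ℝ → ℤ → ℝ} {s : ℝ → ℝ} (hs : Tendsto s l atTop)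
    (h0 : ∀ ε, b ε 0 = 0) (hb : ∀ᶠ ε in l, ∀ n, s ε ≤ b ε (n + 1) - b ε n)
    {w : ℤ → ℝ} (hw : ∀ n, |w n| ≤ 1) (hw0 : w 0 = 0) (hw1 : w 1 = 1) (hw2 : w (-1) = 1)
    (x : EuclideanSpace ℝ (Fin N)) :
    Tendsto (fun ε => (∑' n, w n * U (x - b ε n • EuclideanSpace.single j 1)) /
        decayProfile N (s ε) -
        L₀ * (decayProfile N (b ε 1) / decayProfile N (s ε) * Real.exp (x j) +
          decayProfile N (-b ε (-1)) / decayProfile N (s ε) * Real.exp (-x j))) l (𝓝 0) := by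
  obtain ⟨C, hC, hCb⟩ := hU.exists_translate_div_le hN
  set v : EuclideanSpace ℝ (Fin N) := EuclideanSpace.single j 1 with hv
  have hv1 : ‖v‖ = 1 := by simp [hv]
  have hxv : inner ℝ x v = x j := by simp [hv, EuclideanSpace.inner_single_right]
  have hgap : ∀ᶠ ε in l, ∀ n, s ε * (n.natAbs : ℝ) ≤ |b ε n| :=
    hb.mono fun ε h => mul_natAbs_le_abs_of_gap (h0 ε) h
  have hb1 : ∀ᶠ ε in l, s ε ≤ b ε 1 := hb.mono fun ε h => by
    simpa [h0] using h 0
  have hb2 : ∀ᶠ ε in l, s ε ≤ -b ε (-1) := hb.mono fun ε h => by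
    simpa [h0] using h (-1)
  have hbound : ∀ᶠ ε in l, ∀ n, |w n * U (x - b ε n • v) / decayProfile N (s ε)| ≤
      C * Real.exp ‖x‖ * Real.exp (-(s ε * ((n.natAbs : ℝ) - 1))) := by
    filter_upwards [hgap, hs.eventually_ge_atTop 1, hs.eventually_ge_atTop (2 * ‖x‖)]
      with ε h1 h2 h3
    refine hCb v x (b ε) w (s ε) hv1 h2 h1 hw0 hw fun n hn => ?_
    have hn1 : (1 : ℝ) ≤ n.natAbs := by exact_mod_cast Int.natAbs_pos.2 hn
    have h4 : s ε ≤ |b ε n| := le_trans (by nlinarith) (h1 n)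
    have h5 := norm_sub_norm_le (b ε n • v) x
    rw [norm_smul, hv1, mul_one, Real.norm_eq_abs, norm_sub_rev] at h5
    linarith
  set c : ℝ → ℤ → ℝ := fun ε n =>
    if n = 1 then L₀ * (decayProfile N (b ε 1) / decayProfile N (s ε) * Real.exp (x j))
    else if n = -1 then L₀ * (decayProfile N (-b ε (-1)) / decayProfile N (s ε) * Real.exp (-x j))
    else 0 with hc
  have hρ : ∀ {ε t : ℝ}, 1 ≤ s ε → s ε ≤ t →
      0 ≤ decayProfile N t / decayProfile N (s ε) ∧
        decayProfile N t / decayProfile N (s ε) ≤ 1 := fun {ε t} h1 h2 => by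
    have h3 : 0 < s ε := by linarith
    refine ⟨(div_pos (decayProfile_pos (by linarith)) (decayProfile_pos h3)).le, ?_⟩
    refine (decayProfile_div_le (by omega) h3 h2).trans ?_
    rw [← Real.exp_zero]
    exact Real.exp_le_exp.2 (by linarith)
  have hcsupp : ∀ ε, ∀ n ∉ ({1, -1} : Finset ℤ), c ε n = 0 := fun ε n hn => by
    simp only [Finset.mem_insert, Finset.mem_singleton, not_or] at hn
    simp [hc, hn.1, hn.2]
  have hcsum : ∀ ε, ∑' n, c ε n =
      L₀ * (decayProfile N (b ε 1) / decayProfile N (s ε) * Real.exp (x j) +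
          decayProfile N (-b ε (-1)) / decayProfile N (s ε) * Real.exp (-x j)) := fun ε => by
    rw [tsum_eq_sum (s := {1, -1}) (hcsupp ε), Finset.sum_pair (by norm_num)]
    simp [hc, mul_add]
  have hterm1 : Tendsto (fun ε => w 1 * U (x - b ε 1 • v) / decayProfile N (s ε) - c ε 1) l
      (𝓝 0) := by
    have ht : Tendsto (fun ε => b ε 1) l atTop := tendsto_atTop_mono' _ hb1 hs
    have h1 := ((hU.tendsto_sub_smul_div hv1 x).comp ht).sub_const (L₀ * Real.exp (x j))
    rw [hxv, sub_self] at h1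
    refine squeeze_zero_norm' ?_ (tendsto_zero_iff_norm_tendsto_zero.1 h1)
    filter_upwards [hb1, hs.eventually_ge_atTop 1] with ε h2 h3
    have h4 := hρ h3 h2
    have h5 := (decayProfile_pos (N := N) (by linarith : 0 < b ε 1)).ne'
    have h6 := (decayProfile_pos (N := N) (by linarith : 0 < s ε)).ne'
    rw [show w 1 * U (x - b ε 1 • v) / decayProfile N (s ε) - c ε 1 =
      decayProfile N (b ε 1) / decayProfile N (s ε) *
        (U (x - b ε 1 • v) / decayProfile N (b ε 1) - L₀ * Real.exp (x j)) by
      simp only [hc, hw1, if_true]; field_simp, norm_mul, Real.norm_of_nonneg h4.1]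
    exact mul_le_of_le_one_left (norm_nonneg _) h4.2
  have hterm2 : Tendsto (fun ε => w (-1) * U (x - b ε (-1) • v) / decayProfile N (s ε) -
      c ε (-1)) l (𝓝 0) := by
    have ht : Tendsto (fun ε => -b ε (-1)) l atTop := tendsto_atTop_mono' _ hb2 hs
    have h1 := ((hU.tendsto_sub_smul_div (v := -v) (by simpa using hv1) x).comp ht).sub_const
      (L₀ * Real.exp (-x j))
    rw [inner_neg_right, hxv, sub_self] at h1
    refine squeeze_zero_norm' ?_ (tendsto_zero_iff_norm_tendsto_zero.1 h1)
    filter_upwards [hb2, hs.eventually_ge_atTop 1] with ε h2 h3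
    have h4 := hρ h3 h2
    have h5 := (decayProfile_pos (N := N) (by linarith : 0 < -b ε (-1))).ne'
    have h6 := (decayProfile_pos (N := N) (by linarith : 0 < s ε)).ne'
    simp only [Function.comp, smul_neg, neg_smul, neg_neg]
    rw [show w (-1) * U (x - b ε (-1) • v) / decayProfile N (s ε) - c ε (-1) =
      decayProfile N (-b ε (-1)) / decayProfile N (s ε) *
        (U (x - b ε (-1) • v) / decayProfile N (-b ε (-1)) - L₀ * Real.exp (-x j)) by
      simp only [hc, hw2, if_true, show (-1 : ℤ) ≠ 1 by norm_num, if_false]; field_simp,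
      norm_mul, Real.norm_of_nonneg h4.1]
    exact mul_le_of_le_one_left (norm_nonneg _) h4.2
  have hdecay : ∀ {t : ℝ} {n : ℤ}, 1 ≤ t → n ≠ 0 →
      Real.exp (-(t * ((n.natAbs : ℝ) - 1))) ≤ Real.exp 1 * Real.exp (-(n.natAbs : ℝ)) :=
    fun {t n} ht hn => by
      have hn1 : (1 : ℝ) ≤ n.natAbs := by exact_mod_cast Int.natAbs_pos.2 hn
      rw [← Real.exp_add]
      exact Real.exp_le_exp.2 (by nlinarith)
  have hfb : ∀ᶠ ε in l, ∀ n, |w n * U (x - b ε n • v) / decayProfile N (s ε)| ≤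
      C * Real.exp ‖x‖ * (Real.exp 1 * Real.exp (-(n.natAbs : ℝ))) := by
    filter_upwards [hbound, hs.eventually_ge_atTop 1] with ε h1 h2 n
    rcases eq_or_ne n 0 with rfl | hn
    · simp only [hw0, zero_mul, zero_div, abs_zero]; positivity
    · exact (h1 n).trans (mul_le_mul_of_nonneg_left (hdecay h2 hn) (by positivity))
  have hcb : ∀ᶠ ε in l, ∀ n, |c ε n| ≤
      |L₀| * Real.exp |x j| * (Real.exp 1 * Real.exp (-(n.natAbs : ℝ))) := by
    filter_upwards [hb1, hb2, hs.eventually_ge_atTop 1] with ε h1 h2 h3 n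
    have key : ∀ t y : ℝ, s ε ≤ t → y ≤ |x j| →
        |L₀ * (decayProfile N t / decayProfile N (s ε) * Real.exp y)| ≤
          |L₀| * Real.exp |x j| := fun t y ht hy => by
      have h4 := hρ h3 ht
      rw [abs_mul, abs_mul, abs_of_nonneg h4.1, abs_of_pos (Real.exp_pos _)]
      refine mul_le_mul_of_nonneg_left ?_ (abs_nonneg _)
      exact (mul_le_of_le_one_left (Real.exp_pos _).le h4.2).trans (Real.exp_le_exp.2 hy)
    have hone : Real.exp 1 * Real.exp (-1) = 1 := by rw [← Real.exp_add]; simp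
    by_cases hn1 : n = 1
    · subst hn1
      simpa [hc, hone] using key _ _ h1 (le_abs_self _)
    by_cases hn2 : n = -1
    · subst hn2
      simpa [hc, hone] using key _ _ h2 (neg_le_abs _)
    · rw [hcsupp ε n (by simp [hn1, hn2]), abs_zero]
      positivity
  have hsummable : ∀ K : ℝ, Summable fun n : ℤ => K * (Real.exp 1 * Real.exp (-(n.natAbs : ℝ))) :=
    fun K => (summable_exp_neg_natAbs.mul_left _).mul_left K
  have hlim := tendsto_tsum_of_dominated_convergence (𝓕 := l)
    (f := fun ε (n : ℤ) => w n * U (x - b ε n • v) / decayProfile N (s ε) - c ε n)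
    (g := fun _ => 0)
    (bound := fun n => C * Real.exp ‖x‖ * (Real.exp 1 * Real.exp (-(n.natAbs : ℝ))) +
      |L₀| * Real.exp |x j| * (Real.exp 1 * Real.exp (-(n.natAbs : ℝ))))
    ((hsummable _).add (hsummable _)) (fun n => ?_) ?_
  · rw [tsum_zero] at hlim
    refine hlim.congr' ?_
    filter_upwards [hfb] with ε h1
    have hf : Summable fun n => w n * U (x - b ε n • v) / decayProfile N (s ε) :=
      Summable.of_norm_bounded (hsummable _) h1
    rw [hf.tsum_sub (summable_of_ne_finset_zero (hcsupp ε)), hcsum, tsum_div_const]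
  · by_cases hn1 : n = 1
    · rw [hn1]; exact hterm1
    by_cases hn2 : n = -1
    · rw [hn2]; exact hterm2
    simp_rw [hcsupp _ n (by simp [hn1, hn2] : n ∉ ({1, -1} : Finset ℤ)), sub_zero]
    rcases eq_or_ne n 0 with rfl | hn0
    · simp only [hw0, zero_mul, zero_div]
      exact tendsto_const_nhds
    have hn3 : (2 : ℝ) ≤ n.natAbs := by exact_mod_cast (by omega : 2 ≤ n.natAbs)
    have hz : Tendsto (fun ε => C * Real.exp ‖x‖ * Real.exp (-(s ε * ((n.natAbs : ℝ) - 1)))) l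
        (𝓝 (C * Real.exp ‖x‖ * 0)) :=
      (Real.tendsto_exp_neg_atTop_nhds_zero.comp
        (hs.atTop_mul_const (by linarith))).const_mul _
    rw [mul_zero] at hz
    exact squeeze_zero_norm' (hbound.mono fun ε h => h n) hz
  · filter_upwards [hfb, hcb] with ε h1 h2 n
    exact (norm_sub_le _ _).trans (add_le_add (h1 n) (h2 n))

end IsDecayingSolution

namespace IsDecayingSolution

variable {N : ℕ} {p L₀ : ℝ} {U : EuclideanSpace ℝ (Fin N) → ℝ}

/-- To leading order the interaction integral of a bump with a well separated sequence of
translates is the difference of the decay profiles at its two nearest neighbours. -/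
lemma exists_tendsto_interaction (hU : IsDecayingSolution p L₀ U) (hN : 2 ≤ N) (hp : 2 ≤ p)
    (j : Fin N) :
    ∃ A > 0, ∀ (l : Filter ℝ) [l.IsCountablyGenerated] (b : ℝ → ℤ → ℝ) (s : ℝ → ℝ) (w : ℤ → ℝ)
      (D : ℝ → Set (EuclideanSpace ℝ (Fin N))), Tendsto s l atTop → (∀ ε, b ε 0 = 0) →
      (∀ᶠ ε in l, ∀ n, s ε ≤ b ε (n + 1) - b ε n) →
      (∀ n, |w n| ≤ 1) → w 0 = 0 → w 1 = 1 → w (-1) = 1 → (∀ ε, MeasurableSet (D ε)) →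
      (∀ ε, ∀ x ∈ D ε, ∀ n, |x j| ≤ |x j - b ε n|) → (∀ x, ∀ᶠ ε in l, x ∈ D ε) →
      Tendsto (fun ε => (∫ x in D ε, U x ^ (p - 1) *
          (∑' n, w n * U (x - b ε n • EuclideanSpace.single j 1)) * coordDeriv j U x) /
          decayProfile N (s ε) -
        L₀ * A * (decayProfile N (-b ε (-1)) - decayProfile N (b ε 1)) / decayProfile N (s ε)) l
        (𝓝 0) := by
  obtain ⟨A, hA, hA1, hA2⟩ := hU.exists_moment hN hp j
  refine ⟨A, hA, fun l _ b s w D hs h0 hb hw hw0 hw1 hw2 hDm hDb hDlim => ?_⟩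
  obtain ⟨C, hC, hCb⟩ := hU.exists_translate_div_le hN
  set v : EuclideanSpace ℝ (Fin N) := EuclideanSpace.single j 1 with hv
  have hv1 : ‖v‖ = 1 := by simp [hv]
  have hDc : Continuous (coordDeriv j U) :=
    continuous_coordDeriv j (hU.contDiff.of_le (by norm_num))
  have hcoord : Continuous fun x : EuclideanSpace ℝ (Fin N) => x j :=
    (EuclideanSpace.proj j : EuclideanSpace ℝ (Fin N) →L[ℝ] ℝ).continuous
  have hxj : ∀ x : EuclideanSpace ℝ (Fin N), |x j| ≤ ‖x‖ := fun x => by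
    simpa using PiLp.norm_apply_le x j
  set g : EuclideanSpace ℝ (Fin N) → ℝ := fun x => U x ^ (p - 1) * coordDeriv j U x with hg
  have hgc : Continuous g := (hU.continuous_rpow (p - 1)).mul hDc
  have hgabs : ∀ x, |g x| = U x ^ (p - 1) * |coordDeriv j U x| := fun x => by
    rw [hg, abs_mul, abs_of_nonneg (Real.rpow_nonneg (hU.pos x).le _)]
  set T : ℝ → EuclideanSpace ℝ (Fin N) → ℝ := fun ε x => ∑' n, w n * U (x - b ε n • v) with hT
  have hTm : ∀ ε, Measurable (T ε) := fun ε => Measurable.tsum fun n =>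
    ((hU.contDiff.continuous.comp (continuous_id.sub continuous_const)).const_mul _).measurable
  set ρ : ℝ → ℝ → ℝ := fun ε t => decayProfile N t / decayProfile N (s ε) with hρdef
  have hρ : ∀ {ε t : ℝ}, 1 ≤ s ε → s ε ≤ t → 0 ≤ ρ ε t ∧ ρ ε t ≤ 1 := fun {ε t} h1 h2 => by
    have h3 : 0 < s ε := by linarith
    refine ⟨(div_pos (decayProfile_pos (by linarith)) (decayProfile_pos h3)).le, ?_⟩
    refine (decayProfile_div_le (by omega) h3 h2).trans ?_
    rw [← Real.exp_zero]
    exact Real.exp_le_exp.2 (by linarith)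
  set K := C * Real.exp 1 * ∑' n : ℤ, Real.exp (-(n.natAbs : ℝ)) with hK
  have hTb : ∀ᶠ ε in l, ∀ x ∈ D ε, |T ε x / decayProfile N (s ε)| ≤ K * Real.exp ‖x‖ := by
    filter_upwards [hb, hs.eventually_ge_atTop 1] with ε h1 h2 x hx
    have h3 := hCb v x (b ε) w (s ε) hv1 h2 (mul_natAbs_le_abs_of_gap (h0 ε) h1) hw0 hw
      fun n _ => by
        have e1 := hDb ε x hx n
        have e2 := hxj (x - b ε n • v)
        simp only [hv, PiLp.sub_apply, PiLp.smul_apply, PiLp.single_apply, if_true,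
          smul_eq_mul, mul_one] at e2
        have e3 := abs_sub_abs_le_abs_sub (b ε n) (x j)
        rw [abs_sub_comm] at e3
        linarith
    have h4 : ∀ n : ℤ, ‖w n * U (x - b ε n • v) / decayProfile N (s ε)‖ ≤
        C * Real.exp ‖x‖ * (Real.exp 1 * Real.exp (-(n.natAbs : ℝ))) := fun n => by
      rcases eq_or_ne n 0 with rfl | hn
      · simp only [hw0, zero_mul, zero_div, norm_zero]; positivity
      · have hn1 : (1 : ℝ) ≤ n.natAbs := by exact_mod_cast Int.natAbs_pos.2 hn
        refine (h3 n).trans (mul_le_mul_of_nonneg_left ?_ (by positivity))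
        rw [← Real.exp_add]
        exact Real.exp_le_exp.2 (by nlinarith)
    have h5 := tsum_of_norm_bounded
      (((summable_exp_neg_natAbs.mul_left (Real.exp 1)).mul_left (C * Real.exp ‖x‖)).hasSum) h4
    rw [tsum_div_const, tsum_mul_left, tsum_mul_left] at h5
    refine h5.trans_eq ?_
    rw [hK]; ring
  have hmaj := hU.integrable_exp_norm_mul_rpow_mul_coordDeriv hN hp j
  set Φ : ℝ → EuclideanSpace ℝ (Fin N) → ℝ := fun ε =>
    (D ε).indicator fun x => g x * (T ε x / decayProfile N (s ε)) with hΦ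
  have hΦm : ∀ ε, AEStronglyMeasurable (Φ ε) volume := fun ε =>
    ((hgc.measurable.mul ((hTm ε).div_const _)).indicator (hDm ε)).aestronglyMeasurable
  have hΦb : ∀ᶠ ε in l, ∀ x, ‖Φ ε x‖ ≤
      K * (Real.exp ‖x‖ * (U x ^ (p - 1) * |coordDeriv j U x|)) := by
    filter_upwards [hTb] with ε h1 x
    have hK0 : 0 ≤ K := mul_nonneg (by positivity) (tsum_nonneg fun n => (Real.exp_pos _).le)
    by_cases hx : x ∈ D ε
    · rw [hΦ]
      simp only
      rw [Set.indicator_of_mem hx, norm_mul, Real.norm_eq_abs, Real.norm_eq_abs, hgabs]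
      have h2 : 0 ≤ U x ^ (p - 1) * |coordDeriv j U x| := by
        rw [← hgabs]; exact abs_nonneg _
      nlinarith [mul_le_mul_of_nonneg_left (h1 x hx) h2]
    · rw [hΦ]
      simp only
      rw [Set.indicator_of_notMem hx, norm_zero]
      have := Real.rpow_nonneg (hU.pos x).le (p - 1)
      positivity
  set Ψ : ℝ → EuclideanSpace ℝ (Fin N) → ℝ := fun ε x =>
    g x * (L₀ * (ρ ε (b ε 1) * Real.exp (x j) + ρ ε (-b ε (-1)) * Real.exp (-x j))) with hΨ
  have hb1 : ∀ᶠ ε in l, s ε ≤ b ε 1 := hb.mono fun ε h => by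
    simpa [h0] using h 0
  have hb2 : ∀ᶠ ε in l, s ε ≤ -b ε (-1) := hb.mono fun ε h => by
    simpa [h0] using h (-1)
  have hΨc : ∀ ε, Continuous (Ψ ε) := fun ε =>
    hgc.mul ((((Real.continuous_exp.comp hcoord).const_mul _).add
      ((Real.continuous_exp.comp hcoord.neg).const_mul _)).const_mul _)
  have hΨb : ∀ᶠ ε in l, ∀ x, ‖Ψ ε x‖ ≤
      |L₀| * 2 * (Real.exp ‖x‖ * (U x ^ (p - 1) * |coordDeriv j U x|)) := by
    filter_upwards [hb1, hb2, hs.eventually_ge_atTop 1] with ε h1 h2 h3 x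
    obtain ⟨p1, p2⟩ := hρ h3 h1
    obtain ⟨p3, p4⟩ := hρ h3 h2
    have q1 : ρ ε (b ε 1) * Real.exp (x j) ≤ Real.exp ‖x‖ :=
      (mul_le_of_le_one_left (Real.exp_pos _).le p2).trans
        (Real.exp_le_exp.2 ((le_abs_self _).trans (hxj x)))
    have q2 : ρ ε (-b ε (-1)) * Real.exp (-x j) ≤ Real.exp ‖x‖ :=
      (mul_le_of_le_one_left (Real.exp_pos _).le p4).trans
        (Real.exp_le_exp.2 ((neg_le_abs _).trans (hxj x)))
    have q3 : 0 ≤ ρ ε (b ε 1) * Real.exp (x j) + ρ ε (-b ε (-1)) * Real.exp (-x j) := by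
      positivity
    have hΨx : Ψ ε x = g x * (L₀ * (ρ ε (b ε 1) * Real.exp (x j) +
        ρ ε (-b ε (-1)) * Real.exp (-x j))) := rfl
    rw [hΨx, Real.norm_eq_abs, abs_mul, hgabs, abs_mul, abs_of_nonneg q3]
    have h4 : 0 ≤ U x ^ (p - 1) * |coordDeriv j U x| := by
      rw [← hgabs]; exact abs_nonneg _
    calc _ ≤ U x ^ (p - 1) * |coordDeriv j U x| * (|L₀| * (2 * Real.exp ‖x‖)) := by
          gcongr; linarith
      _ = _ := by ring
  have hΦi : ∀ᶠ ε in l, Integrable (Φ ε) := hΦb.mono fun ε h =>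
    (hmaj.const_mul K).mono' (hΦm ε) (Eventually.of_forall h)
  have hΨi : ∀ᶠ ε in l, Integrable (Ψ ε) := hΨb.mono fun ε h =>
    (hmaj.const_mul (|L₀| * 2)).mono' (hΨc ε).aestronglyMeasurable (Eventually.of_forall h)
  have hlim := tendsto_integral_filter_of_dominated_convergence (μ := volume) (l := l)
    (F := fun ε x => Φ ε x - Ψ ε x) (f := fun _ => 0)
    (fun x => K * (Real.exp ‖x‖ * (U x ^ (p - 1) * |coordDeriv j U x|)) +
      |L₀| * 2 * (Real.exp ‖x‖ * (U x ^ (p - 1) * |coordDeriv j U x|)))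
    (Eventually.of_forall fun ε => (hΦm ε).sub (hΨc ε).aestronglyMeasurable)
    (by
      filter_upwards [hΦb, hΨb] with ε h1 h2
      exact Eventually.of_forall fun x => (norm_sub_le _ _).trans (add_le_add (h1 x) (h2 x)))
    ((hmaj.const_mul _).add (hmaj.const_mul _))
    (Eventually.of_forall fun x => by
      have h1 := (hU.tendsto_tsum_translate hN j hs h0 hb hw hw0 hw1 hw2 x).const_mul (g x)
      rw [mul_zero] at h1
      refine h1.congr' ?_
      filter_upwards [hDlim x] with ε hx
      simp only [hΦ, hΨ, hρdef, hT]
      rw [Set.indicator_of_mem hx, mul_sub])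
  rw [integral_zero] at hlim
  have i1 : Integrable fun x => g x * Real.exp (x j) := by
    refine hmaj.mono' (hgc.mul (Real.continuous_exp.comp hcoord)).aestronglyMeasurable
      (Eventually.of_forall fun x => ?_)
    rw [norm_mul, Real.norm_eq_abs, hgabs, Real.norm_of_nonneg (Real.exp_pos _).le, mul_comm]
    exact mul_le_mul_of_nonneg_right
      (Real.exp_le_exp.2 ((le_abs_self _).trans (hxj x))) (by rw [← hgabs]; exact abs_nonneg _)
  have i2 : Integrable fun x => g x * Real.exp (-x j) := by
    refine hmaj.mono' (hgc.mul (Real.continuous_exp.comp hcoord.neg)).aestronglyMeasurable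
      (Eventually.of_forall fun x => ?_)
    rw [norm_mul, Real.norm_eq_abs, hgabs, Real.norm_of_nonneg (Real.exp_pos _).le, mul_comm]
    exact mul_le_mul_of_nonneg_right
      (Real.exp_le_exp.2 ((neg_le_abs _).trans (hxj x))) (by rw [← hgabs]; exact abs_nonneg _)
  refine hlim.congr' ?_
  filter_upwards [hΦi, hΨi] with ε h1 h2
  rw [integral_sub h1 h2]
  congr 1
  · rw [hΦ, integral_indicator (hDm ε), ← integral_div]
    congr 1
    funext x
    simp only [hg, hT]
    ring
  · have h3 : ∀ x, Ψ ε x = L₀ * ρ ε (b ε 1) * (g x * Real.exp (x j)) +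
        L₀ * ρ ε (-b ε (-1)) * (g x * Real.exp (-x j)) := fun x => by
      simp only [hΨ]; ring
    simp_rw [h3]
    rw [integral_add (i1.const_mul _) (i2.const_mul _), integral_const_mul, integral_const_mul,
      hA1, hA2, hρdef]
    ring

end IsDecayingSolution

/-- The `n`-th point of the `2π`-periodic extension of a configuration of `k` points. -/
noncomputable def periodicPoint (k : ℕ) (hk : 0 < k) (av : Fin k → ℝ) (n : ℤ) : ℝ :=
  av ⟨(n % k).toNat, by have := Int.emod_lt_of_pos n (Int.natCast_pos.2 hk); omega⟩ +
    2 * Real.pi * ((n / k : ℤ) : ℝ)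

lemma exists_eq_add_mul {k : ℕ} (hk : 0 < k) (n : ℤ) : ∃ (i : Fin k) (l : ℤ), n = (i : ℕ) + k * l := by
  have h1 := Int.emod_nonneg n (Int.natCast_pos.2 hk).ne'
  have h2 := Int.emod_lt_of_pos n (Int.natCast_pos.2 hk)
  refine ⟨⟨(n % k).toNat, by omega⟩, n / k, ?_⟩
  simp only [Int.toNat_of_nonneg h1]
  exact (Int.emod_add_mul_ediv n k).symm

lemma add_mul_emod {k : ℕ} (i : Fin k) (l : ℤ) : (((i : ℕ) : ℤ) + k * l) % k = (i : ℕ) := by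
  rw [Int.add_mul_emod_self_left]
  exact Int.emod_eq_of_lt (by omega) (by omega)

section PeriodicPoint

variable {k : ℕ} (hk : 0 < k) (av : Fin k → ℝ)

lemma periodicPoint_add_mul (i : Fin k) (l : ℤ) :
    periodicPoint k hk av ((i : ℕ) + k * l) = av i + 2 * Real.pi * l := by
  have h2 : (((i : ℕ) : ℤ) + k * l) / k = l := by
    rw [Int.add_mul_ediv_left _ _ (by omega), Int.ediv_eq_zero_of_lt (by omega) (by omega), zero_add]
  simp only [periodicPoint, h2, add_mul_emod, Int.toNat_natCast, Fin.eta]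

lemma periodicPoint_natCast (i : Fin k) : periodicPoint k hk av (i : ℕ) = av i := by
  simpa using periodicPoint_add_mul hk av i 0

lemma periodicPoint_succ_sub (i : Fin k) (l : ℤ) :
    periodicPoint k hk av ((i : ℕ) + k * l + 1) - periodicPoint k hk av ((i : ℕ) + k * l) =
      gap k hk av i := by
  rw [periodicPoint_add_mul, gap]
  split_ifs with h
  · have := periodicPoint_add_mul hk av ⟨(i : ℕ) + 1, h⟩ l
    rw [show (((i : ℕ) : ℤ) + k * l + 1) = (((i : ℕ) + 1 : ℕ) : ℤ) + k * l by push_cast; ring, this]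
    ring
  · have := periodicPoint_add_mul hk av ⟨0, hk⟩ (l + 1)
    have hi : ((i : ℕ) : ℤ) + 1 = k := by omega
    rw [show (((i : ℕ) : ℤ) + k * l + 1) = ((0 : ℕ) : ℤ) + k * (l + 1) by
      rw [mul_add, ← hi]; push_cast; ring, this]
    push_cast
    ring

end PeriodicPoint

lemma sum_erase_tsum_eq {k : ℕ} (i : Fin k) {f : ℤ → ℝ} (hf : Summable f) :
    ∑ j ∈ Finset.univ.erase i, ∑' l : ℤ, f ((j : ℕ) + k * l) =
      ∑' n : ℤ, (if n % k = (i : ℕ) then 0 else 1) * f n := by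
  have : NeZero k := ⟨i.pos.ne'⟩
  set g : ℤ → ℝ := fun n => (if n % k = (i : ℕ) then 0 else 1) * f n with hg
  have hgs : Summable g := Summable.of_norm_bounded hf.norm fun n => by
    simp only [hg]
    split_ifs <;> simp
  have he : ∀ q : ℤ × Fin k, (Int.divModEquiv k).symm q = (q.2 : ℕ) + k * q.1 := fun q => by
    simp [Int.divModEquiv, mul_comm, add_comm]
  have hgs' : Summable fun q : ℤ × Fin k => g ((q.2 : ℕ) + k * q.1) := by
    simp_rw [← he]
    exact (Int.divModEquiv k).symm.summable_iff.2 hgs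
  calc _ = ∑ j ∈ Finset.univ.erase i, ∑' l : ℤ, g ((j : ℕ) + k * l) := by
        refine Finset.sum_congr rfl fun j hj => tsum_congr fun l => ?_
        have hji : ((j : ℕ) : ℤ) ≠ (i : ℕ) := fun h =>
          Finset.ne_of_mem_erase hj (Fin.ext (by exact_mod_cast h))
        simp only [hg, add_mul_emod, if_neg hji, one_mul]
    _ = ∑ j : Fin k, ∑' l : ℤ, g ((j : ℕ) + k * l) := by
        refine Finset.sum_erase _ ?_
        simp only [hg, add_mul_emod, if_true, zero_mul, tsum_zero]
    _ = ∑' l : ℤ, ∑ j : Fin k, g ((j : ℕ) + k * l) := by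
        refine (Summable.tsum_finsetSum fun j _ => ?_).symm
        exact hgs'.comp_injective (i := fun l : ℤ => (l, j)) fun l l' h => (Prod.ext_iff.1 h).1
    _ = ∑' q : ℤ × Fin k, g ((q.2 : ℕ) + k * q.1) := by
        rw [hgs'.tsum_prod]
        simp_rw [tsum_fintype]
    _ = ∑' n, g n := by
        simp_rw [← he]
        exact (Int.divModEquiv k).symm.tsum_eq g

namespace IsDecayingSolution

variable {N : ℕ} {p L₀ : ℝ} {U : EuclideanSpace ℝ (Fin N) → ℝ}

lemma summable_translate (hU : IsDecayingSolution p L₀ U) (hN : 2 ≤ N)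
    {v : EuclideanSpace ℝ (Fin N)} (hv : ‖v‖ = 1) {b : ℤ → ℝ}
    (hb : ∀ n : ℤ, (n.natAbs : ℝ) ≤ |b n|) (x : EuclideanSpace ℝ (Fin N)) :
    Summable fun n => U (x - b n • v) := by
  obtain ⟨C, hC, h⟩ := hU.exists_decay hN
  refine Summable.of_norm_bounded (summable_exp_neg_natAbs.mul_left (C * Real.exp ‖x‖))
    fun n => ?_
  have h1 := norm_sub_norm_le (b n • v) x
  rw [norm_smul, hv, mul_one, Real.norm_eq_abs, norm_sub_rev] at h1
  rw [Real.norm_of_nonneg (hU.pos _).le, mul_assoc, ← Real.exp_add]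
  refine (h _).trans (mul_le_mul_of_nonneg_left (Real.exp_le_exp.2 ?_) hC.le)
  linarith [hb n]

end IsDecayingSolution

/-- The part of a period consisting of the points at least as close to the `i`-th peak as to every
other peak. -/
def peakCell {N k : ℕ} (j : Fin N) (av : Fin k → ℝ) (ε : ℝ) (i : Fin k) :
    Set (EuclideanSpace ℝ (Fin N)) :=
  {x | |x j| ≤ Real.pi / ε ∧ ∀ (j' : Fin k) (l : ℤ),
    |x j - av i / ε| ≤ |x j - (av j' + 2 * Real.pi * (l : ℝ)) / ε|}

lemma measurableSet_peakCell {N k : ℕ} (j : Fin N) (av : Fin k → ℝ) (ε : ℝ) (i : Fin k) :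
    MeasurableSet (peakCell j av ε i) := by
  have hcoord : Continuous fun x : EuclideanSpace ℝ (Fin N) => x j :=
    (EuclideanSpace.proj j : EuclideanSpace ℝ (Fin N) →L[ℝ] ℝ).continuous
  refine ((isClosed_le hcoord.abs continuous_const).inter ?_).measurableSet
  have : IsClosed {x : EuclideanSpace ℝ (Fin N) | ∀ (j' : Fin k) (l : ℤ),
      |x j - av i / ε| ≤ |x j - (av j' + 2 * Real.pi * (l : ℝ)) / ε|} := by
    simp only [Set.ofPred_forall]
    exact isClosed_iInter fun j' => isClosed_iInter fun l =>
      isClosed_le (hcoord.sub continuous_const).abs (hcoord.sub continuous_const).abs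
  exact this

lemma two_mul_sigmin_le {k : ℕ} (hk : 0 < k) (av : Fin k → ℝ) {ε : ℝ} (hε : 0 < ε) (i : Fin k) :
    2 * sigmin k hk av ε ≤ gap k hk av i / ε := by
  rw [sigmin, mul_div_assoc', mul_div_mul_left _ _ two_ne_zero]
  exact div_le_div_of_nonneg_right (Finset.inf'_le _ (Finset.mem_univ i)) hε.le

lemma exists_two_mul_sigmin_eq {k : ℕ} (hk : 0 < k) (av : Fin k → ℝ) (ε : ℝ) :
    ∃ i, 2 * sigmin k hk av ε = gap k hk av i / ε := by
  obtain ⟨i, -, hi⟩ := Finset.exists_mem_eq_inf' (⟨⟨0, hk⟩, Finset.mem_univ _⟩ :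
    (Finset.univ : Finset (Fin k)).Nonempty) (gap k hk av)
  exact ⟨i, by rw [sigmin, hi]; ring⟩

lemma two_mul_sigmin_le_sub {k : ℕ} (hk : 0 < k) (av : Fin k → ℝ) {ε : ℝ} (hε : 0 < ε) (n : ℤ) :
    2 * sigmin k hk av ε ≤
      (periodicPoint k hk av (n + 1) - periodicPoint k hk av n) / ε := by
  obtain ⟨i, l, rfl⟩ := exists_eq_add_mul hk n
  rw [periodicPoint_succ_sub]
  exact two_mul_sigmin_le hk av hε i

namespace IsDecayingSolution

variable {N : ℕ} {p L₀ : ℝ} {U : EuclideanSpace ℝ (Fin N) → ℝ}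

/-- The interaction integral of a peak, recentred at that peak. -/
lemma integral_peakCell_eq (hU : IsDecayingSolution p L₀ U) (hN : 2 ≤ N) (j : Fin N) {k : ℕ}
    (hk : 0 < k) (av : Fin k → ℝ) (ε : ℝ) (i : Fin k)
    (hb : ∀ n : ℤ, (n.natAbs : ℝ) ≤ |(periodicPoint k hk av ((i : ℕ) + n) - av i) / ε|) :
    ∫ x in peakCell j av ε i, U (x - (av i / ε) • EuclideanSpace.single j 1) ^ (p - 1) *
        (∑ j' ∈ Finset.univ.erase i, ∑' l : ℤ,
          U (x - ((av j' + 2 * Real.pi * (l : ℝ)) / ε) • EuclideanSpace.single j 1)) *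
        deriv (fun t : ℝ => U (x - (av i / ε) • EuclideanSpace.single j 1 +
          t • EuclideanSpace.single j 1)) 0 =
      ∫ y in (fun y => y + (av i / ε) • EuclideanSpace.single j 1) ⁻¹' peakCell j av ε i,
        U y ^ (p - 1) * (∑' n : ℤ, (if ((i : ℕ) + n : ℤ) % k = (i : ℕ) then 0 else 1) *
          U (y - ((periodicPoint k hk av ((i : ℕ) + n) - av i) / ε) •
            EuclideanSpace.single j 1)) * coordDeriv j U y := by
  set v : EuclideanSpace ℝ (Fin N) := EuclideanSpace.single j 1 with hv
  have hv1 : ‖v‖ = 1 := by simp [hv]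
  rw [← (measurePreserving_add_right volume ((av i / ε) • v)).setIntegral_preimage_emb
    (measurableEmbedding_addRight _)]
  congr 1
  funext y
  rw [add_sub_cancel_right, deriv_line (hU.contDiff.differentiable (by norm_num)), zero_smul,
    add_zero]
  congr 2
  have hshift : ∀ n : ℤ, y - ((periodicPoint k hk av ((i : ℕ) + n) - av i) / ε) • v =
      y + (av i / ε) • v - (periodicPoint k hk av ((i : ℕ) + n) / ε) • v := fun n => by
    rw [sub_div, sub_smul]; abel
  have hsum : Summable fun n : ℤ =>
      U (y + (av i / ε) • v - (periodicPoint k hk av n / ε) • v) := by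
    have h1 := hU.summable_translate hN hv1 hb y
    simp_rw [hshift] at h1
    exact (Equiv.addLeft ((i : ℕ) : ℤ)).summable_iff.1 h1
  have h2 := sum_erase_tsum_eq i hsum
  simp_rw [periodicPoint_add_mul] at h2
  rw [h2]
  simp_rw [hshift]
  exact ((Equiv.addLeft ((i : ℕ) : ℤ)).tsum_eq fun n : ℤ =>
    (if n % k = (i : ℕ) then (0 : ℝ) else 1) *
      U (y + (av i / ε) • v - (periodicPoint k hk av n / ε) • v)).symm

/-- If the interaction integral of a peak vanishes at leading order, the decay profiles at the two
adjacent gaps agree at leading order. -/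
lemma tendsto_decayProfile_sub (hU : IsDecayingSolution p L₀ U) (hN : 2 ≤ N) (hp : 2 ≤ p)
    (hL₀ : 0 < L₀) (j : Fin N) {k : ℕ} (hk : 0 < k) (hk2 : 2 ≤ k) (a : ℝ → Fin k → ℝ)
    {l : Filter ℝ} [l.IsCountablyGenerated] (hl : ∀ᶠ ε in l, 0 < ε)
    (hs : Tendsto (fun ε => 2 * sigmin k hk (a ε) ε) l atTop) (i : Fin k)
    (hL : Tendsto (fun ε => (a ε i + Real.pi) / ε) l atTop)
    (hR : Tendsto (fun ε => (Real.pi - a ε i) / ε) l atTop)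
    (hD : Tendsto (fun ε : ℝ =>
      (∫ x in peakCell j (a ε) ε i, U (x - (a ε i / ε) • EuclideanSpace.single j 1) ^ (p - 1) *
        (∑ j' ∈ Finset.univ.erase i, ∑' l : ℤ,
          U (x - ((a ε j' + 2 * Real.pi * (l : ℝ)) / ε) • EuclideanSpace.single j 1)) *
        deriv (fun t : ℝ => U (x - (a ε i / ε) • EuclideanSpace.single j 1 +
          t • EuclideanSpace.single j 1)) 0) * Real.exp (2 * sigmin k hk (a ε) ε) *
        (sigmin k hk (a ε) ε) ^ (((N : ℝ) - 1) / 2)) l (𝓝 0)) :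
    Tendsto (fun ε =>
      decayProfile N ((periodicPoint k hk (a ε) (i : ℕ) -
          periodicPoint k hk (a ε) ((i : ℕ) - 1)) / ε) /
        decayProfile N (2 * sigmin k hk (a ε) ε) -
      decayProfile N ((periodicPoint k hk (a ε) ((i : ℕ) + 1) -
          periodicPoint k hk (a ε) (i : ℕ)) / ε) /
        decayProfile N (2 * sigmin k hk (a ε) ε)) l (𝓝 0) := by
  obtain ⟨A, hA, hint⟩ := hU.exists_tendsto_interaction hN hp j
  set v : EuclideanSpace ℝ (Fin N) := EuclideanSpace.single j 1 with hv
  set s : ℝ → ℝ := fun ε => 2 * sigmin k hk (a ε) ε with hsdef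
  set b : ℝ → ℤ → ℝ := fun ε n => (periodicPoint k hk (a ε) ((i : ℕ) + n) - a ε i) / ε with hbdef
  have hb0 : ∀ ε, b ε 0 = 0 := fun ε => by
    simp [hbdef, periodicPoint_natCast]
  have hgap : ∀ᶠ ε in l, ∀ n, s ε ≤ b ε (n + 1) - b ε n := by
    filter_upwards [hl] with ε hε n
    have := two_mul_sigmin_le_sub hk (a ε) hε ((i : ℕ) + n)
    simp only [hbdef, hsdef]
    rwa [← sub_div, sub_sub_sub_cancel_right, ← add_assoc]
  have habs : ∀ᶠ ε in l, ∀ n : ℤ, s ε * n.natAbs ≤ |b ε n| :=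
    hgap.mono fun ε h => mul_natAbs_le_abs_of_gap (hb0 ε) h
  have hik : (i : ℕ) < k := i.isLt
  have hmem : ∀ (ε : ℝ) (y : EuclideanSpace ℝ (Fin N)), y + (a ε i / ε) • v ∈ peakCell j (a ε) ε i ↔
      |y j + a ε i / ε| ≤ Real.pi / ε ∧ ∀ n, |y j| ≤ |y j - b ε n| := fun ε y => by
    have hy : (y + (a ε i / ε) • v) j = y j + a ε i / ε := by simp [hv]
    rw [peakCell, Set.mem_ofPred_eq, hy, add_sub_cancel_right]
    refine and_congr_right fun _ => ⟨fun h n => ?_, fun h j' m => ?_⟩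
    · obtain ⟨j', m, hn⟩ := exists_eq_add_mul hk ((i : ℕ) + n)
      have := h j' m
      simp only [hbdef]
      rw [hn, periodicPoint_add_mul, sub_div]
      convert this using 2
      ring
    · have := h ((j' : ℕ) + k * m - (i : ℕ))
      simp only [hbdef] at this
      rw [add_sub_cancel, periodicPoint_add_mul, sub_div] at this
      convert this using 2
      ring
  have hmod : ∀ {n : ℤ}, n ≠ 0 → n.natAbs < k → ((i : ℕ) + n : ℤ) % k ≠ (i : ℕ) := by
    intro n hn hnk h
    have h2 : (k : ℤ) ∣ n := by
      have := Int.dvd_self_sub_emod (x := (i : ℕ) + n) (m := k)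
      rwa [h, add_sub_cancel_left] at this
    exact hnk.not_ge (Int.natAbs_dvd_natAbs.2 h2 |> Nat.le_of_dvd (Int.natAbs_pos.2 hn))
  have key := hint l b s (fun n => if ((i : ℕ) + n : ℤ) % k = (i : ℕ) then 0 else 1)
    (fun ε => (fun y => y + (a ε i / ε) • v) ⁻¹' peakCell j (a ε) ε i) hs hb0 hgap
    (fun n => by split_ifs <;> simp)
    (by simp [Int.emod_eq_of_lt (Int.natCast_nonneg (i : ℕ)) (Int.ofNat_lt.2 hik)])
    (if_neg fun h => hmod one_ne_zero (by simp; omega) h)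
    (if_neg fun h => hmod (neg_ne_zero.2 one_ne_zero) (by simp; omega) h)
    (fun ε => (measurable_add_const _) (measurableSet_peakCell j (a ε) ε i))
    (fun ε y hy => ((hmem ε y).1 hy).2)
    (fun y => by
      filter_upwards [hl, habs, hs.eventually_ge_atTop 1, hs.eventually_ge_atTop (2 * |y j|),
        hL.eventually_ge_atTop |y j|, hR.eventually_ge_atTop |y j|] with ε hε h1 h2 h3 h4 h5
      refine (hmem ε y).2 ⟨?_, fun n => ?_⟩
      · rw [add_div] at h4
        rw [sub_div] at h5
        rw [abs_le]
        constructor <;> linarith [le_abs_self (y j), neg_abs_le (y j)]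
      · rcases eq_or_ne n 0 with rfl | hn
        · rw [hb0, sub_zero]
        · have hn1 : (1 : ℝ) ≤ n.natAbs := by exact_mod_cast Int.natAbs_pos.2 hn
          have h6 : s ε ≤ |b ε n| := le_trans (by nlinarith) (h1 n)
          have h7 := abs_sub_abs_le_abs_sub (b ε n) (y j)
          rw [abs_sub_comm] at h7
          linarith)
  have hD' := (hD.mul_const ((2 : ℝ) ^ (((N : ℝ) - 1) / 2))).sub key
  rw [zero_mul, sub_zero] at hD'
  have hD'' := hD'.mul_const (L₀ * A)⁻¹
  rw [zero_mul] at hD''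
  refine hD''.congr' ?_
  filter_upwards [hl, habs, hs.eventually_ge_atTop 1] with ε hε h1 h2
  have hσ : 0 < sigmin k hk (a ε) ε := by
    have : (1 : ℝ) ≤ 2 * sigmin k hk (a ε) ε := h2
    linarith
  rw [hU.integral_peakCell_eq hN j hk (a ε) ε i fun n =>
    le_trans (le_mul_of_one_le_left (Nat.cast_nonneg _) h2) (h1 n)]
  have hFinv : Real.exp (2 * sigmin k hk (a ε) ε) * (sigmin k hk (a ε) ε) ^ (((N : ℝ) - 1) / 2) *
      2 ^ (((N : ℝ) - 1) / 2) = (decayProfile N (s ε))⁻¹ := by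
    rw [decayProfile, mul_inv, Real.rpow_neg (by positivity), inv_inv, Real.exp_neg, inv_inv,
      Real.mul_rpow zero_le_two hσ.le]
    ring
  have hF := (decayProfile_pos (N := N) (by linarith : 0 < s ε)).ne'
  have hb1 : b ε 1 = (periodicPoint k hk (a ε) ((i : ℕ) + 1) -
      periodicPoint k hk (a ε) (i : ℕ)) / ε := by
    rw [periodicPoint_natCast]
  have hb2 : -b ε (-1) = (periodicPoint k hk (a ε) (i : ℕ) -
      periodicPoint k hk (a ε) ((i : ℕ) - 1)) / ε := by
    rw [periodicPoint_natCast]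
    simp only [hbdef, ← sub_eq_add_neg]
    ring
  rw [← hb1, ← hb2]
  have halg : ∀ I E r t F x y : ℝ, E * r * t = F⁻¹ → F ≠ 0 →
      (I * E * r * t - (I / F - L₀ * A * (x - y) / F)) * (L₀ * A)⁻¹ = x / F - y / F := by
    intro I E r t F x y h hF
    have := hA.ne'
    have := hL₀.ne'
    rw [mul_assoc I, mul_assoc I, h]
    field_simp
    ring
  exact halg _ _ _ _ _ _ _ hFinv hF

end IsDecayingSolution

/-- If the relative decay profiles of finitely many large quantities agree asymptotically, the
quantities are asymptotically equal to their average. -/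
lemma tendsto_sub_average {N : ℕ} (hN : 1 ≤ N) {ι : Type*} [Fintype ι] [Nonempty ι] {l : Filter ℝ}
    {s : ℝ → ℝ} {t : ℝ → ι → ℝ} (hs : Tendsto s l atTop)
    (hle : ∀ᶠ ε in l, ∀ i, s ε ≤ t ε i) (hmin : ∀ᶠ ε in l, ∃ i, s ε = t ε i)
    (h : ∀ i j, Tendsto (fun ε => decayProfile N (t ε i) / decayProfile N (s ε) -
      decayProfile N (t ε j) / decayProfile N (s ε)) l (𝓝 0)) (i : ι) :
    Tendsto (fun ε => t ε i - (∑ j, t ε j) / Fintype.card ι) l (𝓝 0) := by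
  have hratio : ∀ i, Tendsto (fun ε => decayProfile N (t ε i) / decayProfile N (s ε)) l (𝓝 1) := by
    intro i
    rw [tendsto_iff_norm_sub_tendsto_zero]
    have h0 : Tendsto (fun ε => ∑ j, |decayProfile N (t ε i) / decayProfile N (s ε) -
        decayProfile N (t ε j) / decayProfile N (s ε)|) l (𝓝 0) := by
      simpa using tendsto_finsetSum Finset.univ fun j _ => (h i j).abs
    refine squeeze_zero' (Eventually.of_forall fun _ => norm_nonneg _) ?_ h0
    filter_upwards [hmin, hs.eventually_gt_atTop 0] with ε ⟨j, hj⟩ hs0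
    refine le_trans (le_of_eq ?_) (Finset.single_le_sum (f := fun j =>
      |decayProfile N (t ε i) / decayProfile N (s ε) -
        decayProfile N (t ε j) / decayProfile N (s ε)|) (fun j _ => abs_nonneg _)
      (Finset.mem_univ j))
    simp only [← hj, div_self (decayProfile_pos hs0).ne', Real.norm_eq_abs]
  have hdiff : ∀ i, Tendsto (fun ε => t ε i - s ε) l (𝓝 0) := by
    intro i
    have hexp : Tendsto (fun ε => Real.exp (-(t ε i - s ε))) l (𝓝 1) := by
      refine tendsto_of_tendsto_of_tendsto_of_le_of_le' (hratio i) tendsto_const_nhds ?_ ?_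
      · filter_upwards [hle, hs.eventually_gt_atTop 0] with ε h1 h2
        exact decayProfile_div_le hN h2 (h1 i)
      · filter_upwards [hle] with ε h1
        exact Real.exp_le_one_iff.2 (by linarith [h1 i])
    have := ((Real.continuousAt_log one_ne_zero).tendsto.comp hexp).neg
    simpa [Function.comp_def] using this
  have hsum := (tendsto_finsetSum Finset.univ fun j _ => hdiff j).div_const (Fintype.card ι : ℝ)
  have := (hdiff i).sub hsum
  simp only [Finset.sum_const_zero, zero_div, sub_zero] at this
  refine this.congr fun ε => ?_
  have hc : (Fintype.card ι : ℝ) ≠ 0 := by exact_mod_cast Fintype.card_ne_zero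
  rw [Finset.sum_sub_distrib, Finset.sum_const, Finset.card_univ, nsmul_eq_mul]
  field_simp
  ring

lemma sum_gap {k : ℕ} (hk : 0 < k) (av : Fin k → ℝ) : ∑ i, gap k hk av i = 2 * Real.pi := by
  have h1 : ∀ i : Fin k, gap k hk av i =
      periodicPoint k hk av (((i : ℕ) + 1 : ℕ) : ℤ) - periodicPoint k hk av ((i : ℕ) : ℤ) := by
    intro i
    simpa using (periodicPoint_succ_sub hk av i 0).symm
  have h2 := periodicPoint_add_mul hk av ⟨0, hk⟩ 1
  have h3 := periodicPoint_natCast hk av ⟨0, hk⟩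
  simp_rw [h1]
  rw [Fin.sum_univ_eq_sum_range (fun n : ℕ => periodicPoint k hk av ((n + 1 : ℕ) : ℤ) -
    periodicPoint k hk av (n : ℤ)), Finset.sum_range_sub fun n : ℕ => periodicPoint k hk av (n : ℤ)]
  simp only [CharP.cast_eq_zero, zero_add, mul_one, Int.cast_one] at h2 h3 ⊢
  rw [h2, h3]
  ring

namespace IsDecayingSolution

variable {N : ℕ} {p L₀ : ℝ} {U : EuclideanSpace ℝ (Fin N) → ℝ}

/-- If all interaction integrals vanish at leading order, the decay profiles at all gaps agree at
leading order. -/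
lemma tendsto_decayProfile_gap_sub (hU : IsDecayingSolution p L₀ U) (hN : 2 ≤ N) (hp : 2 ≤ p)
    (hL₀ : 0 < L₀) (j : Fin N) {k : ℕ} (hk : 0 < k) (hk2 : 2 ≤ k) (a : ℝ → Fin k → ℝ)
    (hrange : ∀ᶠ ε in 𝓝[>] (0 : ℝ), ∀ i, a ε i ∈ Set.Ico (-Real.pi) Real.pi)
    (hgap : ∀ i, Tendsto (fun ε => gap k hk (a ε) i / ε) (𝓝[>] (0 : ℝ)) atTop)
    (hs : Tendsto (fun ε => 2 * sigmin k hk (a ε) ε) (𝓝[>] (0 : ℝ)) atTop)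
    (hD : ∀ i, Tendsto (fun ε : ℝ =>
      (∫ x in peakCell j (a ε) ε i, U (x - (a ε i / ε) • EuclideanSpace.single j 1) ^ (p - 1) *
        (∑ j' ∈ Finset.univ.erase i, ∑' l : ℤ,
          U (x - ((a ε j' + 2 * Real.pi * (l : ℝ)) / ε) • EuclideanSpace.single j 1)) *
        deriv (fun t : ℝ => U (x - (a ε i / ε) • EuclideanSpace.single j 1 +
          t • EuclideanSpace.single j 1)) 0) * Real.exp (2 * sigmin k hk (a ε) ε) *
        (sigmin k hk (a ε) ε) ^ (((N : ℝ) - 1) / 2)) (𝓝[>] (0 : ℝ)) (𝓝 0)) (i i' : Fin k) :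
    Tendsto (fun ε => decayProfile N (gap k hk (a ε) i / ε) /
        decayProfile N (2 * sigmin k hk (a ε) ε) -
      decayProfile N (gap k hk (a ε) i' / ε) / decayProfile N (2 * sigmin k hk (a ε) ε))
      (𝓝[>] (0 : ℝ)) (𝓝 0) := by
  set G : ℝ → Fin k → ℝ := fun ε i => decayProfile N (gap k hk (a ε) i / ε) /
    decayProfile N (2 * sigmin k hk (a ε) ε) with hG
  have hpos : ∀ᶠ ε in 𝓝[>] (0 : ℝ), 0 < ε := eventually_mem_nhdsWithin
  have hstep : ∀ (S : Set ℝ) (m i : Fin k),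
      (∀ av, periodicPoint k hk av (i : ℕ) - periodicPoint k hk av ((i : ℕ) - 1) = gap k hk av m) →
      (∀ᶠ ε in 𝓝[>] (0 : ℝ) ⊓ 𝓟 S, gap k hk (a ε) m / 2 ≤ a ε i + Real.pi) →
      (∀ᶠ ε in 𝓝[>] (0 : ℝ) ⊓ 𝓟 S, gap k hk (a ε) i / 2 ≤ Real.pi - a ε i) →
      Tendsto (fun ε => G ε m - G ε i) (𝓝[>] (0 : ℝ) ⊓ 𝓟 S) (𝓝 0) := by
    intro S m i hm hL hR
    have hpos' : ∀ᶠ ε in 𝓝[>] (0 : ℝ) ⊓ 𝓟 S, 0 < ε := hpos.filter_mono inf_le_left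
    have hbig : ∀ (m : Fin k) (f : ℝ → ℝ),
        (∀ᶠ ε in 𝓝[>] (0 : ℝ) ⊓ 𝓟 S, gap k hk (a ε) m / 2 ≤ f ε) →
        Tendsto (fun ε => f ε / ε) (𝓝[>] (0 : ℝ) ⊓ 𝓟 S) atTop := by
      intro m f hf
      refine tendsto_atTop_mono' _ ?_
        (((hgap m).mono_left inf_le_left).atTop_div_const (zero_lt_two' ℝ))
      filter_upwards [hpos', hf] with ε h0 h1
      rw [div_right_comm]
      exact div_le_div_of_nonneg_right h1 h0.le
    have key := hU.tendsto_decayProfile_sub hN hp hL₀ j hk hk2 a hpos' (hs.mono_left inf_le_left) i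
      (hbig m _ hL) (hbig i _ hR) ((hD i).mono_left inf_le_left)
    have hi : ∀ av, periodicPoint k hk av ((i : ℕ) + 1) - periodicPoint k hk av (i : ℕ) =
        gap k hk av i := fun av => by simpa using periodicPoint_succ_sub hk av i 0
    simpa only [hm, hi] using key
  have hlast : k - 1 < k := by omega
  have hgap_last : ∀ av, gap k hk av ⟨k - 1, hlast⟩ = av ⟨0, hk⟩ + 2 * Real.pi - av ⟨k - 1, hlast⟩ := by
    intro av
    rw [gap, dif_neg (by simp; omega)]
  have hprev : ∀ (n : ℕ) (hn : n + 1 < k) (av : Fin k → ℝ),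
      periodicPoint k hk av ((n + 1 : ℕ) : ℤ) - periodicPoint k hk av (((n + 1 : ℕ) : ℤ) - 1) =
        gap k hk av ⟨n, by omega⟩ := by
    intro n hn av
    have := periodicPoint_succ_sub hk av ⟨n, by omega⟩ 0
    simpa using this
  have hleft : ∀ (n : ℕ) (hn : n + 1 < k), ∀ᶠ ε in 𝓝[>] (0 : ℝ),
      gap k hk (a ε) ⟨n, by omega⟩ / 2 ≤ a ε ⟨n + 1, hn⟩ + Real.pi := by
    intro n hn
    filter_upwards [hrange] with ε h
    have h1 := (h ⟨n, by omega⟩).1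
    have h2 := (h ⟨n + 1, hn⟩).1
    simp only [gap, dif_pos hn]
    linarith
  have hright : ∀ (n : ℕ) (hn : n + 1 < k), ∀ᶠ ε in 𝓝[>] (0 : ℝ),
      gap k hk (a ε) ⟨n, by omega⟩ / 2 ≤ Real.pi - a ε ⟨n, by omega⟩ := by
    intro n hn
    filter_upwards [hrange] with ε h
    have h1 := (h ⟨n, by omega⟩).2
    have h2 := (h ⟨n + 1, hn⟩).2
    simp only [gap, dif_pos hn]
    linarith
  have hinner : ∀ (n : ℕ) (hn : n + 1 < k), Tendsto (fun ε => G ε ⟨n, by omega⟩ - G ε ⟨0, hk⟩)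
      (𝓝[>] (0 : ℝ)) (𝓝 0) := by
    intro n
    induction n with
    | zero => intro _; simp
    | succ n ih =>
      intro hn
      have h1 := hstep Set.univ ⟨n, by omega⟩ ⟨n + 1, by omega⟩ (hprev n (by omega))
        ((hleft n (by omega)).filter_mono inf_le_left)
        ((hright (n + 1) hn).filter_mono inf_le_left)
      rw [principal_univ, inf_top_eq] at h1
      simpa using (ih (by omega)).sub h1
  have hbase : ∀ i, Tendsto (fun ε => G ε i - G ε ⟨0, hk⟩) (𝓝[>] (0 : ℝ)) (𝓝 0) := by
    rintro ⟨n, hn⟩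
    rcases Nat.lt_or_ge (n + 1) k with hn' | hn'
    · exact hinner n hn'
    obtain rfl : n = k - 1 := by omega
    set S : Set ℝ := {ε | gap k hk (a ε) ⟨k - 1, hlast⟩ / 2 ≤ a ε ⟨0, hk⟩ + Real.pi} with hS
    have h1 := hstep S ⟨k - 1, hlast⟩ ⟨0, hk⟩
      (fun av => by
        have := periodicPoint_succ_sub hk av ⟨k - 1, hlast⟩ (-1)
        rw [← this]
        simp only [Nat.cast_pred hk]
        congr 2 <;> simp <;> ring)
      (mem_inf_of_right (mem_principal_self S)) ((hright 0 hk2).filter_mono inf_le_left)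
    have h2 : Tendsto (fun ε => G ε ⟨k - 1, hlast⟩ - G ε ⟨0, hk⟩) (𝓝[>] (0 : ℝ) ⊓ 𝓟 Sᶜ) (𝓝 0) := by
      obtain ⟨n, rfl⟩ : ∃ n, k = n + 2 := ⟨k - 2, by omega⟩
      have h3 := hstep Sᶜ ⟨n, by omega⟩ ⟨n + 1, by omega⟩ (hprev n (by omega))
        ((hleft n (by omega)).filter_mono inf_le_left)
        (mem_inf_of_right (mem_principal.2 fun ε hε => by
          have h4 : ¬ gap (n + 2) hk (a ε) ⟨n + 1, hlast⟩ / 2 ≤ a ε ⟨0, hk⟩ + Real.pi := hε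
          have h5 := hgap_last (a ε)
          simp only [Nat.add_one_sub_one] at h5
          show gap (n + 2) hk (a ε) ⟨n + 1, hlast⟩ / 2 ≤ Real.pi - a ε ⟨n + 1, hlast⟩
          linarith))
      simpa using ((hinner n (by omega)).mono_left inf_le_left).sub h3
    have h3 := h1.sup h2
    rwa [← inf_sup_left, sup_principal, Set.union_compl_self, principal_univ, inf_top_eq] at h3
  simpa using (hbase i).sub (hbase i')

end IsDecayingSolution

/-- If `u` is a positive solution with peaks at `a ε i / ε` (mutual distances tending to
infinity) and the Lyapunov–Schmidt coefficients `d_i` all vanish (expressed by the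
vanishing, at the relevant scale `e^{-2σ̲}σ̲^{(1-N)/2}`, of the interaction integrals
`∫_{Ω_i} U_i^{p-1} (Σ_{j≠i} v_j) ∂U_i/∂x₁`), then the peaks are asymptotically
equidistributed: `(a_ε^{i+1} - a_ε^i)/ε - 2π/(kε) → 0` as `ε → 0⁺`. -/
theorem stmt17 (N : ℕ) (hN : 2 ≤ N) (p : ℝ) (hp : 2 ≤ p)
    (hpsub : 3 ≤ N → p < ((N : ℝ) + 2) / ((N : ℝ) - 2))
    (U : EuclideanSpace ℝ (Fin N) → ℝ)
    (hUpos : ∀ x, 0 < U x) (hUsmooth : ContDiff ℝ (⊤ : ℕ∞) U)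
    (hUeq : ∀ x, -(lap U x) + U x = U x ^ p)
    (hUasym : ∃ L₀ > 0, Tendsto
      (fun x : EuclideanSpace ℝ (Fin N) => ‖x‖ ^ (((N : ℝ) - 1) / 2) * Real.exp ‖x‖ * U x)
      (Filter.comap (fun x : EuclideanSpace ℝ (Fin N) => ‖x‖) Filter.atTop) (nhds L₀))
    (k : ℕ) (hk : 0 < k)
    (a : ℝ → Fin k → ℝ) (u : ℝ → EuclideanSpace ℝ (Fin N) → ℝ)
    (hrange : ∀ᶠ ε in 𝓝[>] (0 : ℝ), ∀ i, a ε i ∈ Set.Ico (-Real.pi) Real.pi)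
    (hmono : ∀ᶠ ε in 𝓝[>] (0 : ℝ), ∀ i j : Fin k, i < j → a ε i < a ε j)
    (hseprate : ∀ i, Tendsto (fun ε => gap k hk (a ε) i / ε) (𝓝[>] (0 : ℝ)) atTop)
    (hsol : ∀ ε : ℝ, 0 < ε →
      ContDiff ℝ 2 (u ε) ∧ (∀ x, 0 < u ε x) ∧ (∀ x, Mcal p (u ε) x = 0) ∧
      (∀ x, u ε (x + (2 * Real.pi / ε) • e1 N) = u ε x) ∧
      (∀ δ : ℝ, 0 < δ → ∃ R : ℝ, ∀ x : EuclideanSpace ℝ (Fin N),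
        R ≤ ‖x - x (⟨0, by omega⟩ : Fin N) • e1 N‖ → |u ε x| ≤ δ))
    (hpeaks : ∀ δ : ℝ, 0 < δ → ∀ᶠ ε in 𝓝[>] (0 : ℝ),
      ∀ x : EuclideanSpace ℝ (Fin N), |x (⟨0, by omega⟩ : Fin N)| ≤ Real.pi / ε →
        |u ε x - ∑ i : Fin k, U (x - (a ε i / ε) • e1 N)| ≤ δ)
    (hD : ∀ i : Fin k, Tendsto (fun ε : ℝ =>
        (∫ x in {x : EuclideanSpace ℝ (Fin N) |
            |x (⟨0, by omega⟩ : Fin N)| ≤ Real.pi / ε ∧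
            ∀ (j : Fin k) (l : ℤ), |x (⟨0, by omega⟩ : Fin N) - a ε i / ε|
              ≤ |x (⟨0, by omega⟩ : Fin N) - (a ε j + 2 * Real.pi * (l : ℝ)) / ε|},
          U (x - (a ε i / ε) • e1 N) ^ (p - 1) *
            (∑ j ∈ Finset.univ.erase i,
              ∑' l : ℤ, U (x - ((a ε j + 2 * Real.pi * (l : ℝ)) / ε) • e1 N)) *
            deriv (fun t : ℝ => U (x - (a ε i / ε) • e1 N + t • e1 N)) 0) *
          Real.exp (2 * sigmin k hk (a ε) ε) *
          (sigmin k hk (a ε) ε) ^ (((N : ℝ) - 1) / 2))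
      (𝓝[>] (0 : ℝ)) (nhds 0)) :
    ∀ i : Fin k, Tendsto
      (fun ε : ℝ => gap k hk (a ε) i / ε - 2 * Real.pi / (k * ε))
      (𝓝[>] (0 : ℝ)) (nhds 0) := by
  obtain ⟨L₀, hL₀, hUlim⟩ := hUasym
  have hU : IsDecayingSolution p L₀ U :=
    ⟨hUpos, contDiff_infty.1 hUsmooth 2, fun x => by linarith [hUeq x], hUlim⟩
  have he1 : e1 N = EuclideanSpace.single (⟨0, by omega⟩ : Fin N) 1 := dif_pos (by omega)
  have hpos : ∀ᶠ ε in 𝓝[>] (0 : ℝ), 0 < ε := eventually_mem_nhdsWithin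
  have : Nonempty (Fin k) := ⟨⟨0, hk⟩⟩
  have hs : Tendsto (fun ε => 2 * sigmin k hk (a ε) ε) (𝓝[>] (0 : ℝ)) atTop := by
    refine tendsto_atTop.2 fun C => ?_
    filter_upwards [eventually_all.2 fun i => (hseprate i).eventually_ge_atTop C] with ε h
    obtain ⟨i, hi⟩ := exists_two_mul_sigmin_eq hk (a ε) ε
    exact hi ▸ h i
  have hdiff : ∀ i i' : Fin k, Tendsto (fun ε => decayProfile N (gap k hk (a ε) i / ε) /
        decayProfile N (2 * sigmin k hk (a ε) ε) -
      decayProfile N (gap k hk (a ε) i' / ε) / decayProfile N (2 * sigmin k hk (a ε) ε))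
      (𝓝[>] (0 : ℝ)) (𝓝 0) := by
    rcases Nat.lt_or_ge k 2 with hk1 | hk2
    · obtain rfl : k = 1 := by omega
      intro i i'
      simp [Subsingleton.elim i i']
    · rw [he1] at hD
      exact hU.tendsto_decayProfile_gap_sub hN hp hL₀ ⟨0, by omega⟩ hk hk2 a hrange hseprate hs hD
  intro i
  refine (tendsto_sub_average (by omega) hs
    (hpos.mono fun ε hε i => two_mul_sigmin_le hk (a ε) hε i)
    (Eventually.of_forall fun ε => exists_two_mul_sigmin_eq hk (a ε) ε) hdiff i).congr fun ε => ?_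
  rw [← Finset.sum_div, sum_gap, Fintype.card_fin, div_div, mul_comm ε]
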